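/- arXiv:2107.07363 — 3 statements merged into one kernel-verified Lean document; each statement's English description precedes it below -/
import Mathlib

section
/- Let H(x) = |x|²/2 be the quadratic Hamiltonian on ℝ², and for each ε > 0 let X^ε : [0,∞) × Ω → ℝ² be the pathwise C¹ solution of dX_t^ε/dt = ε⁻²∇⊥H(X_t^ε) + ε⁻¹ v(t/ε²) e₂ with X_0^ε = X_0 ∈ ℝ², where ∇⊥ = (∂_y, −∂_x) and e₂ = (0,1). Then, as ε → 0, H(X^ε) converges in distribution to H(W^D): for every T > 0 the laws on C([0,T], ℝ) of the processes t ↦ H(X_t^ε) converge weakly to the law of t ↦ H(W_t^D), where W^D is a two-dimensional Brownian motion with W_0^D = X_0, independent components, and covariance E[(W_t^D − X_0)(W_s^D − X_0)ᵀ] = (t ∧ s)·D with D = D₁₁·Id₂ and D₁₁ = lim_{x→∞} ∫_0^x R(z) cos(z) dz. -/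
open MeasureTheory Filter Topology

/-- The quadratic Hamiltonian `H(x,y) = (x² + y²)/2 = |X|²/2` on `ℝ²`. -/
noncomputable def quadH : ℝ × ℝ → ℝ := fun p => (p.1 ^ 2 + p.2 ^ 2) / 2

lemma quadH_continuous : Continuous quadH := by
  unfold quadH; fun_prop

/-- The coordinate functions on `ℝ²`. -/
def coord2 : Fin 2 → ℝ × ℝ → ℝ := ![Prod.fst, Prod.snd]

/-- The restriction of a continuous real-indexed path to `[0,T]`, as an element of
`C([0,T], α)`. -/
noncomputable def restrictPath {α : Type*} [TopologicalSpace α] (T : ℝ) (g : ℝ → α)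
    (hg : Continuous g) : C(Set.Icc (0:ℝ) T, α) :=
  ⟨fun t => g t, hg.comp continuous_subtype_val⟩

section Interpolation

/-- The hat function on `[0,T]` centred at the grid point `T * i / N`. -/
noncomputable def hatFun (T : ℝ) (N : ℕ) (i : ℕ) (t : ℝ) : ℝ := max 0 (1 - |N * t / T - i|)

lemma hatFun_nonneg (T : ℝ) (N i : ℕ) (t : ℝ) : 0 ≤ hatFun T N i t := le_max_left _ _

lemma abs_lt_of_hatFun_ne_zero {T : ℝ} {N i : ℕ} {t : ℝ} (h : hatFun T N i t ≠ 0) :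
    |N * t / T - i| < 1 := by
  by_contra! hc
  exact h (max_eq_left (by linarith))

lemma continuous_hatFun (T : ℝ) (N i : ℕ) : Continuous (hatFun T N i) := by
  unfold hatFun; fun_prop

lemma sum_hatFun_pos {T : ℝ} (hT : 0 < T) (N : ℕ) {t : ℝ} (ht : t ∈ Set.Icc 0 T) :
    0 < ∑ i : Fin (N + 1), hatFun T N i t := by
  have hx0 : 0 ≤ N * t / T := by have := ht.1; positivity
  have hxN : N * t / T ≤ N := by
    rw [div_le_iff₀ hT]; exact mul_le_mul_of_nonneg_left ht.2 (by positivity)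
  have hfl : ⌊N * t / T⌋₊ < N + 1 := Nat.lt_succ_of_le (Nat.floor_le_of_le hxN)
  refine Finset.sum_pos' (fun i _ => hatFun_nonneg ..) ⟨⟨_, hfl⟩, Finset.mem_univ _, ?_⟩
  refine lt_max_of_lt_right ?_
  have h1 := Nat.floor_le hx0
  have h2 := Nat.lt_floor_add_one (N * t / T)
  have : |N * t / T - (⌊N * t / T⌋₊ : ℝ)| < 1 := by rw [abs_lt]; constructor <;> linarith
  simpa using this

variable {E : Type*} [NormedAddCommGroup E] [NormedSpace ℝ E]

/-- Interpolation of the values `p` at the `N + 1` equally spaced points of `[0,T]`. -/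
noncomputable def gridInterp {T : ℝ} (hT : 0 < T) (N : ℕ) (p : Fin (N + 1) → E) :
    C(Set.Icc (0:ℝ) T, E) :=
  ⟨fun t => ∑ i : Fin (N + 1), (hatFun T N i t / ∑ j : Fin (N + 1), hatFun T N j t) • p i, by
    refine continuous_finsetSum _ fun i _ => Continuous.smul ?_ continuous_const
    refine Continuous.div ((continuous_hatFun ..).comp continuous_subtype_val)
      (continuous_finsetSum _ fun j _ => (continuous_hatFun ..).comp continuous_subtype_val)
      fun t => (sum_hatFun_pos hT N t.2).ne'⟩

lemma continuous_gridInterp {T : ℝ} (hT : 0 < T) (N : ℕ) :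
    Continuous (gridInterp (E := E) hT N) := by
  refine ContinuousMap.continuous_of_continuous_uncurry _ ?_
  change Continuous fun q : (Fin (N + 1) → E) × Set.Icc (0:ℝ) T => ∑ i : Fin (N + 1),
    (hatFun T N i q.2 / ∑ j : Fin (N + 1), hatFun T N j q.2) • q.1 i
  refine continuous_finsetSum _ fun i _ => Continuous.smul ?_ (by fun_prop)
  refine Continuous.div ((continuous_hatFun ..).comp (by fun_prop))
    (continuous_finsetSum _ fun j _ => (continuous_hatFun ..).comp (by fun_prop))
    fun q => (sum_hatFun_pos hT N q.2.2).ne'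

lemma dist_gridInterp_le {T : ℝ} (hT : 0 < T) (N : ℕ) (p : Fin (N + 1) → E)
    (t : Set.Icc (0:ℝ) T) (y : E) (B : ℝ)
    (h : ∀ i : Fin (N + 1), |N * (t:ℝ) / T - (i:ℕ)| < 1 → dist y (p i) ≤ B) :
    dist y (gridInterp hT N p t) ≤ B := by
  have hS := sum_hatFun_pos hT N t.2
  set S := ∑ i : Fin (N + 1), hatFun T N i t
  have h1 : ∑ i : Fin (N + 1), hatFun T N i t / S = 1 := by
    rw [← Finset.sum_div, div_self hS.ne']
  have h2 : y - gridInterp hT N p t = ∑ i : Fin (N + 1), (hatFun T N i t / S) • (y - p i) := by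
    simp only [smul_sub, Finset.sum_sub_distrib, ← Finset.sum_smul, h1, one_smul]
    rfl
  rw [dist_eq_norm, h2]
  calc _ ≤ ∑ i : Fin (N + 1), ‖(hatFun T N i t / S) • (y - p i)‖ := norm_sum_le _ _
    _ ≤ ∑ i : Fin (N + 1), (hatFun T N i t / S) * B := by
        refine Finset.sum_le_sum fun i _ => ?_
        have hw : 0 ≤ hatFun T N i t / S := div_nonneg (hatFun_nonneg ..) hS.le
        rw [norm_smul, Real.norm_of_nonneg hw]
        by_cases h0 : hatFun T N i t = 0
        · simp [h0]
        · refine mul_le_mul_of_nonneg_left ?_ hw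
          rw [← dist_eq_norm]
          exact h i (abs_lt_of_hatFun_ne_zero h0)
    _ = B := by rw [← Finset.sum_mul, h1, one_mul]

end Interpolation

section Chaining

variable {E : Type*} [PseudoEMetricSpace E]

lemma edist_dyadic_floor_le_tsum {T : ℝ} (hT : 0 < T) {g : ℝ → E} (hg : Continuous g)
    {u : ℕ → ENNReal}
    (hu : ∀ k i : ℕ, i < 2 ^ k → edist (g (T * i / 2 ^ k)) (g (T * (i + 1 : ℕ) / 2 ^ k)) ≤ u k)
    (n : ℕ) {t : ℝ} (ht : t ∈ Set.Icc 0 T) :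
    edist (g (T * ⌊2 ^ n * t / T⌋₊ / 2 ^ n)) (g t) ≤ ∑' m, u (n + m + 1) := by
  have key := edist_le_tsum_of_edist_le_of_tendsto
    (f := fun k : ℕ => g (T * ⌊2 ^ k * t / T⌋₊ / 2 ^ k)) (fun k => u (k + 1)) ?_ (a := g t) ?_ n
  · simpa using key
  · intro k
    have hx0 : 0 ≤ 2 ^ k * t / T := by have := ht.1; positivity
    have hx1 : 2 ^ k * t / T ≤ 2 ^ k := by
      rw [div_le_iff₀ hT]; exact mul_le_mul_of_nonneg_left ht.2 (by positivity)
    set x := 2 ^ k * t / T with hx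
    have hx2 : (2:ℝ) ^ (k + 1) * t / T = 2 * x := by rw [hx]; ring
    set m := ⌊x⌋₊ with hm
    have h1 : (m:ℝ) ≤ x := Nat.floor_le hx0
    have h2 : x < m + 1 := Nat.lt_floor_add_one x
    have hbase : T * (m:ℝ) / 2 ^ k = T * ((2 * m : ℕ) : ℝ) / 2 ^ (k + 1) := by
      push_cast; rw [pow_succ]; field_simp
    simp only [Nat.succ_eq_add_one, hx2]
    rw [hbase]
    rcases lt_or_ge (2 * x) (2 * m + 1) with h | h
    · have : ⌊2 * x⌋₊ = 2 * m := by
        rw [Nat.floor_eq_iff (by positivity)]; push_cast; constructor <;> linarith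
      rw [this, edist_self]; exact zero_le
    · have : ⌊2 * x⌋₊ = 2 * m + 1 := by
        rw [Nat.floor_eq_iff (by positivity)]; push_cast; constructor <;> linarith
      rw [this]
      refine hu (k + 1) (2 * m) ?_
      have : ((2 * m : ℕ) : ℝ) < ((2 ^ (k + 1) : ℕ) : ℝ) := by
        push_cast; rw [pow_succ]; linarith
      exact_mod_cast this
  · refine (hg.tendsto t).comp ?_
    have h0 : Tendsto (fun k : ℕ => T * ((2:ℝ)⁻¹) ^ k) atTop (𝓝 0) := by
      simpa using (tendsto_pow_atTop_nhds_zero_of_lt_one (by norm_num : (0:ℝ) ≤ 2⁻¹)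
        (by norm_num)).const_mul T
    rw [← tendsto_sub_nhds_zero_iff]
    refine squeeze_zero_norm (fun k => ?_) h0
    have hx0 : 0 ≤ 2 ^ k * t / T := by have := ht.1; positivity
    have h1 := Nat.floor_le hx0
    have h2 := Nat.lt_floor_add_one (2 ^ k * t / T)
    have e : T * ⌊2 ^ k * t / T⌋₊ / 2 ^ k - t
        = T * (2⁻¹) ^ k * (⌊2 ^ k * t / T⌋₊ - 2 ^ k * t / T) := by
      rw [inv_pow]; field_simp
    rw [e, norm_mul, Real.norm_of_nonneg (by positivity)]
    refine mul_le_of_le_one_right (by positivity) ?_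
    rw [Real.norm_eq_abs, abs_le]; constructor <;> linarith

lemma edist_grid_le_tsum {T : ℝ} (hT : 0 < T) {g : ℝ → E} (hg : Continuous g)
    {u : ℕ → ENNReal}
    (hu : ∀ k i : ℕ, i < 2 ^ k → edist (g (T * i / 2 ^ k)) (g (T * (i + 1 : ℕ) / 2 ^ k)) ≤ u k)
    (n : ℕ) {t : ℝ} (ht : t ∈ Set.Icc 0 T) (i : ℕ) (hi : i ≤ 2 ^ n)
    (hit : |2 ^ n * t / T - i| < 1) :
    edist (g t) (g (T * i / 2 ^ n)) ≤ ∑' m, u (n + m) := by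
  have hx0 : 0 ≤ 2 ^ n * t / T := by have := ht.1; positivity
  have h1 := Nat.floor_le hx0
  have h2 := Nat.lt_floor_add_one (2 ^ n * t / T)
  have h3 := edist_dyadic_floor_le_tsum hT hg hu n ht
  generalize ⌊2 ^ n * t / T⌋₊ = m at h1 h2 h3
  rw [abs_lt] at hit
  have hlo : m < i + 1 := by
    have : (m:ℝ) < ((i + 1 : ℕ) : ℝ) := by push_cast; linarith
    exact_mod_cast this
  have hhi : i < m + 2 := by
    have : (i:ℝ) < ((m + 2 : ℕ) : ℝ) := by push_cast; linarith
    exact_mod_cast this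
  have h4 : edist (g (T * m / 2 ^ n)) (g (T * i / 2 ^ n)) ≤ u n := by
    obtain rfl | rfl : i = m ∨ i = m + 1 := by omega
    · simp
    · exact hu n m (by omega)
  calc _ ≤ edist (g t) (g (T * m / 2 ^ n)) + edist (g (T * m / 2 ^ n)) (g (T * i / 2 ^ n)) :=
        edist_triangle _ _ _
    _ ≤ (∑' k, u (n + k + 1)) + u n := add_le_add (by rwa [edist_comm]) h4
    _ = ∑' k, u (n + k) := by
        rw [add_comm, tsum_eq_zero_add' (f := fun k => u (n + k)) ENNReal.summable]
        simp [add_assoc]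

end Chaining

section MomentBound

variable {E : Type*} [NormedAddCommGroup E] [NormedSpace ℝ E]

lemma edist_gridInterp_le {T : ℝ} (hT : 0 < T) (N : ℕ) (p : Fin (N + 1) → E)
    (t : Set.Icc (0:ℝ) T) (y : E) (B : ENNReal)
    (h : ∀ i : Fin (N + 1), |N * (t:ℝ) / T - (i:ℕ)| < 1 → edist y (p i) ≤ B) :
    edist y (gridInterp hT N p t) ≤ B := by
  rcases eq_or_ne B ⊤ with rfl | hB
  · exact le_top
  lift B to NNReal using hB
  have := dist_gridInterp_le hT N p t y B fun i hi => by
    have := h i hi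
    rw [edist_nndist, ENNReal.coe_le_coe] at this
    exact_mod_cast this
  rw [edist_nndist, ENNReal.coe_le_coe]
  exact_mod_cast this

lemma edist_restrictPath_gridInterp_le_tsum {T : ℝ} (hT : 0 < T) {g : ℝ → E} (hg : Continuous g)
    {u : ℕ → ENNReal}
    (hu : ∀ k i : ℕ, i < 2 ^ k → edist (g (T * i / 2 ^ k)) (g (T * (i + 1 : ℕ) / 2 ^ k)) ≤ u k)
    (n : ℕ) :
    edist (restrictPath T g hg)
      (gridInterp hT (2 ^ n) fun i => g (T * (i : ℕ) / 2 ^ n)) ≤ ∑' m, u (n + m) := by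
  rw [ContinuousMap.edist_eq_iSup]
  refine iSup_le fun t => edist_gridInterp_le hT _ _ t _ _ fun i hi => ?_
  push_cast at hi
  exact edist_grid_le_tsum hT hg hu n t.2 i (Nat.lt_succ_iff.mp i.2) hi

lemma ENNReal.le_add_pow_four_mul (x : ENNReal) {a : ℝ} (ha : 0 < a) :
    x ≤ ENNReal.ofReal a + x ^ 4 * ENNReal.ofReal (a⁻¹ ^ 3) := by
  rcases le_total x (ENNReal.ofReal a) with h | h
  · exact h.trans le_self_add
  · refine le_trans ?_ le_add_self
    have h1 : 1 ≤ x * ENNReal.ofReal a⁻¹ := by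
      calc (1 : ENNReal) = ENNReal.ofReal a * ENNReal.ofReal a⁻¹ := by
            rw [← ENNReal.ofReal_mul ha.le, mul_inv_cancel₀ ha.ne', ENNReal.ofReal_one]
        _ ≤ _ := by gcongr
    calc x = x * 1 ^ 3 := by simp
      _ ≤ x * (x * ENNReal.ofReal a⁻¹) ^ 3 := by gcongr
      _ = _ := by rw [ENNReal.ofReal_pow (by positivity)]; ring

variable [MeasurableSpace E] [BorelSpace E] [SecondCountableTopology E]

/-- A Kolmogorov-type bound: the mean uniform distance between a continuous process whose increments
satisfy a fourth moment bound and its dyadic interpolations decays geometrically. -/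
lemma lintegral_edist_restrictPath_gridInterp_le {Ω : Type*} [MeasurableSpace Ω] (P : Measure Ω)
    [IsProbabilityMeasure P] {T C ρ : ℝ} (hT : 0 < T) (hC : 0 ≤ C) (hρ : 0 < ρ) (hρ1 : ρ < 1)
    (hρ4 : ρ ^ 4 = 2⁻¹) {Z : ℝ → Ω → E} (hZ : ∀ ω, Continuous fun t => Z t ω)
    (hZm : ∀ t, Measurable (Z t))
    (hmom : ∀ s t, 0 ≤ s → s ≤ t → t ≤ T →
      ∫⁻ ω, edist (Z s ω) (Z t ω) ^ 4 ∂P ≤ ENNReal.ofReal (C * (t - s) ^ 2)) (n : ℕ) :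
    ∫⁻ ω, edist (restrictPath T (fun t => Z t ω) (hZ ω))
      (gridInterp hT (2 ^ n) fun i => Z (T * (i : ℕ) / 2 ^ n) ω) ∂P
      ≤ ENNReal.ofReal ((1 + C * T ^ 2) * ρ ^ n * (1 - ρ)⁻¹) := by
  set u : ℕ → Ω → ENNReal := fun k ω => ENNReal.ofReal (ρ ^ k) +
    ∑ i ∈ Finset.range (2 ^ k), edist (Z (T * i / 2 ^ k) ω) (Z (T * (i + 1 : ℕ) / 2 ^ k) ω) ^ 4
      * ENNReal.ofReal ((ρ ^ k)⁻¹ ^ 3) with hu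
  have hm : ∀ s t, Measurable fun ω => edist (Z s ω) (Z t ω) := fun s t =>
    (hZm s).edist (hZm t)
  have hum : ∀ k, Measurable (u k) := fun k =>
    measurable_const.add (Finset.measurable_sum _ fun i _ => ((hm _ _).pow_const _).mul_const _)
  have h_int : ∀ k, ∫⁻ ω, u k ω ∂P ≤ ENNReal.ofReal ((1 + C * T ^ 2) * ρ ^ k) := by
    intro k
    rw [hu]
    simp only
    rw [lintegral_add_left measurable_const, lintegral_const, measure_univ, mul_one,
      lintegral_finsetSum _ fun i _ => ((hm _ _).pow_const _).mul_const _]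
    have hi : ∀ i ∈ Finset.range (2 ^ k),
        ∫⁻ ω, edist (Z (T * i / 2 ^ k) ω) (Z (T * (i + 1 : ℕ) / 2 ^ k) ω) ^ 4
          * ENNReal.ofReal ((ρ ^ k)⁻¹ ^ 3) ∂P
        ≤ ENNReal.ofReal (C * (T / 2 ^ k) ^ 2 * (ρ ^ k)⁻¹ ^ 3) := by
      intro i hi
      rw [Finset.mem_range] at hi
      rw [lintegral_mul_const _ ((hm _ _).pow_const _), ENNReal.ofReal_mul (by positivity)]
      gcongr
      refine (hmom _ _ (by positivity) (by gcongr; simp) ?_).trans_eq ?_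
      · rw [mul_div_assoc]
        refine mul_le_of_le_one_right hT.le ?_
        rw [div_le_one (by positivity)]
        exact_mod_cast hi
      · congr 3; push_cast; ring
    refine (add_le_add_right (Finset.sum_le_sum hi) _).trans_eq ?_
    rw [Finset.sum_const, Finset.card_range, ← ENNReal.ofReal_nsmul,
      ← ENNReal.ofReal_add (by positivity) (by positivity)]
    congr 1
    have h2 : ((2:ℝ) ^ k) = ((ρ ^ k)⁻¹) ^ 4 := by
      rw [← inv_inv (2:ℝ), ← hρ4]; simp only [inv_pow]; ring
    rw [nsmul_eq_mul]; push_cast; rw [h2]; field_simp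
  calc _ ≤ ∫⁻ ω, ∑' m, u (n + m) ω ∂P := by
        refine lintegral_mono fun ω => ?_
        refine edist_restrictPath_gridInterp_le_tsum hT (hZ ω) (u := fun k => u k ω) ?_ n
        intro k i hi
        refine (ENNReal.le_add_pow_four_mul _ (pow_pos hρ k)).trans ?_
        refine add_le_add_right ?_ _
        exact Finset.single_le_sum (f := fun i : ℕ =>
          edist (Z (T * i / 2 ^ k) ω) (Z (T * (i + 1 : ℕ) / 2 ^ k) ω) ^ 4
            * ENNReal.ofReal ((ρ ^ k)⁻¹ ^ 3)) (fun _ _ => zero_le) (Finset.mem_range.mpr hi)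
    _ = ∑' m, ∫⁻ ω, u (n + m) ω ∂P := lintegral_tsum fun m => (hum _).aemeasurable
    _ ≤ ∑' m, ENNReal.ofReal ((1 + C * T ^ 2) * ρ ^ n * ρ ^ m) := by
        refine ENNReal.tsum_le_tsum fun m => (h_int _).trans_eq ?_
        rw [pow_add, mul_assoc]
    _ = _ := by
        rw [← ENNReal.ofReal_tsum_of_nonneg (fun m => by positivity)
          ((summable_geometric_of_lt_one hρ.le hρ1).mul_left _), tsum_mul_left,
          tsum_geometric_of_lt_one hρ.le hρ1]

end MomentBound

section FunctionalConvergence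

variable {E : Type*} [NormedAddCommGroup E] [NormedSpace ℝ E]

lemma tendsto_gridInterp_restrictPath {T : ℝ} (hT : 0 < T) {g : ℝ → E} (hg : Continuous g) :
    Tendsto (fun n : ℕ => gridInterp hT (2 ^ n) fun i => g (T * (i : ℕ) / 2 ^ n)) atTop
      (𝓝 (restrictPath T g hg)) := by
  have huc := isCompact_Icc.uniformContinuousOn_of_continuous (hg.continuousOn (s := Set.Icc 0 T))
  rw [Metric.uniformContinuousOn_iff] at huc
  rw [Metric.tendsto_nhds]
  intro δ hδ
  obtain ⟨η, hη, hgη⟩ := huc (δ / 2) (by positivity)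
  have h0 : Tendsto (fun k : ℕ => T * ((2:ℝ)⁻¹) ^ k) atTop (𝓝 0) := by
    simpa using (tendsto_pow_atTop_nhds_zero_of_lt_one (by norm_num : (0:ℝ) ≤ 2⁻¹)
      (by norm_num)).const_mul T
  filter_upwards [h0.eventually_lt_const hη] with n hn
  rw [dist_comm]
  refine lt_of_le_of_lt ?_ (half_lt_self hδ)
  rw [ContinuousMap.dist_le (by positivity)]
  refine fun t => dist_gridInterp_le hT _ _ t _ _ fun i hi => (hgη _ t.2 _ ?_ ?_).le
  · have hiN : ((i : ℕ) : ℝ) ≤ 2 ^ n := by exact_mod_cast Nat.lt_succ_iff.mp i.2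
    refine ⟨by positivity, ?_⟩
    rw [mul_div_assoc]
    exact mul_le_of_le_one_right hT.le ((div_le_one (by positivity)).mpr hiN)
  · push_cast at hi
    have e : (t:ℝ) - T * (i : ℕ) / 2 ^ n = T * 2⁻¹ ^ n * (2 ^ n * t / T - (i : ℕ)) := by
      rw [inv_pow]; field_simp
    rw [Real.dist_eq, e, abs_mul, abs_of_pos (by positivity)]
    refine lt_of_le_of_lt ?_ hn
    exact mul_le_of_le_one_right (by positivity) hi.le

variable [MeasurableSpace E] [BorelSpace E] [SecondCountableTopology E]

lemma measurable_restrictPath {Ω : Type*} [MeasurableSpace Ω] {T : ℝ} (hT : 0 < T)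
    [MeasurableSpace C(Set.Icc (0:ℝ) T, E)] [BorelSpace C(Set.Icc (0:ℝ) T, E)]
    {Z : ℝ → Ω → E} (hZ : ∀ ω, Continuous fun t => Z t ω) (hZm : ∀ t, Measurable (Z t)) :
    Measurable fun ω => restrictPath T (fun t => Z t ω) (hZ ω) := by
  refine measurable_of_tendsto_metrizable (f := fun (n : ℕ) ω =>
    gridInterp hT (2 ^ n) fun i => Z (T * (i : ℕ) / 2 ^ n) ω) (fun n => ?_) ?_
  · exact (continuous_gridInterp hT _).measurable.comp (measurable_pi_lambda _ fun i => hZm _)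
  · rw [tendsto_pi_nhds]
    exact fun ω => tendsto_gridInterp_restrictPath hT (hZ ω)

lemma abs_integral_sub_le_of_lintegral_edist_le {Ω M : Type*} [MeasurableSpace Ω] (P : Measure Ω)
    [IsProbabilityMeasure P] [PseudoMetricSpace M] [MeasurableSpace M] [BorelSpace M]
    {f : M → ℝ} {K : ℝ}
    (hb : ∀ x y, dist (f x) (f y) ≤ K) {L : NNReal} (hL : LipschitzWith L f) {X Y : Ω → M}
    (hX : Measurable X) (hY : Measurable Y) {b : ℝ} (hb0 : 0 ≤ b)
    (h : ∫⁻ ω, edist (X ω) (Y ω) ∂P ≤ ENNReal.ofReal b) :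
    dist (∫ ω, f (X ω) ∂P) (∫ ω, f (Y ω) ∂P) ≤ L * b := by
  have h_int : ∀ X : Ω → M, Measurable X → Integrable (fun ω => f (X ω)) P := by
    intro X hX
    obtain ⟨ω₀⟩ : Nonempty Ω := nonempty_of_isProbabilityMeasure P
    refine Integrable.of_bound (hL.continuous.measurable.comp hX).aestronglyMeasurable
      (‖f (X ω₀)‖ + K) (ae_of_all _ fun ω => ?_)
    have := hb (X ω) (X ω₀)
    rw [dist_eq_norm] at this
    have h2 := norm_sub_norm_le (f (X ω)) (f (X ω₀))
    linarith
  rw [dist_eq_norm, ← integral_sub (h_int X hX) (h_int Y hY)]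
  refine (norm_integral_le_lintegral_norm _).trans ?_
  refine ENNReal.toReal_le_of_le_ofReal (by positivity) ?_
  calc _ ≤ ∫⁻ ω, L * edist (X ω) (Y ω) ∂P := by
        refine lintegral_mono fun ω => ?_
        rw [ofReal_norm, ← edist_eq_enorm_sub]
        exact hL _ _
    _ ≤ L * ENNReal.ofReal b := by
        rw [lintegral_const_mul' _ _ ENNReal.coe_ne_top]
        gcongr
    _ = _ := by rw [ENNReal.ofReal_mul (by positivity), ENNReal.ofReal_coe_nnreal]

/-- Convergence of the finite dimensional distributions together with a uniform fourth moment bound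
on the increments implies convergence in distribution in `C([0,T], E)`. -/
theorem tendsto_integral_restrictPath_of_fdd {Ω Ω' : Type*} [MeasurableSpace Ω]
    [MeasurableSpace Ω'] (P : Measure Ω) [IsProbabilityMeasure P] (P' : Measure Ω')
    [IsProbabilityMeasure P'] {T C : ℝ} (hT : 0 < T) (hC : 0 ≤ C)
    {Z : ℕ → ℝ → Ω → E} (hZ : ∀ n ω, Continuous fun t => Z n t ω)
    (hZm : ∀ n t, Measurable (Z n t))
    (hZmom : ∀ n s t, 0 ≤ s → s ≤ t → t ≤ T →
      ∫⁻ ω, edist (Z n s ω) (Z n t ω) ^ 4 ∂P ≤ ENNReal.ofReal (C * (t - s) ^ 2))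
    {W : ℝ → Ω' → E} (hW : ∀ ω, Continuous fun t => W t ω)
    (hWm : ∀ t, Measurable (W t))
    (hWmom : ∀ s t, 0 ≤ s → s ≤ t → t ≤ T →
      ∫⁻ ω, edist (W s ω) (W t ω) ^ 4 ∂P' ≤ ENNReal.ofReal (C * (t - s) ^ 2))
    (hfdd : ∀ (N : ℕ) (τ : Fin (N + 1) → ℝ), (∀ i, 0 ≤ τ i) →
      ∀ F : BoundedContinuousFunction (Fin (N + 1) → E) ℝ,
        Tendsto (fun n => ∫ ω, F (fun i => Z n (τ i) ω) ∂P) atTop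
          (𝓝 (∫ ω, F (fun i => W (τ i) ω) ∂P')))
    (f : BoundedContinuousFunction C(Set.Icc (0:ℝ) T, E) ℝ) :
    Tendsto (fun n => ∫ ω, f (restrictPath T (fun t => Z n t ω) (hZ n ω)) ∂P) atTop
      (𝓝 (∫ ω, f (restrictPath T (fun t => W t ω) (hW ω)) ∂P')) := by
  let _ : MeasurableSpace C(Set.Icc (0:ℝ) T, E) := borel _
  have : BorelSpace C(Set.Icc (0:ℝ) T, E) := ⟨rfl⟩
  have mZ n := measurable_restrictPath hT (hZ n) (hZm n)
  have mW := measurable_restrictPath hT hW hWm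
  let μ : ℕ → ProbabilityMeasure C(Set.Icc (0:ℝ) T, E) := fun n =>
    ⟨P.map fun ω => restrictPath T (fun t => Z n t ω) (hZ n ω),
      Measure.isProbabilityMeasure_map (mZ n).aemeasurable⟩
  let ν : ProbabilityMeasure C(Set.Icc (0:ℝ) T, E) :=
    ⟨P'.map fun ω => restrictPath T (fun t => W t ω) (hW ω),
      Measure.isProbabilityMeasure_map mW.aemeasurable⟩
  have key : Tendsto μ atTop (𝓝 ν) := by
    rw [tendsto_iff_forall_lipschitz_integral_tendsto]
    rintro f ⟨K, hK⟩ ⟨L, hL⟩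
    have hfm := hL.continuous.measurable
    have e1 : ∀ n, ∫ x, f x ∂(μ n : Measure C(Set.Icc (0:ℝ) T, E))
        = ∫ ω, f (restrictPath T (fun t => Z n t ω) (hZ n ω)) ∂P := fun n =>
      integral_map (mZ n).aemeasurable hfm.aestronglyMeasurable
    have e2 : ∫ x, f x ∂(ν : Measure C(Set.Icc (0:ℝ) T, E))
        = ∫ ω, f (restrictPath T (fun t => W t ω) (hW ω)) ∂P' :=
      integral_map mW.aemeasurable hfm.aestronglyMeasurable
    simp only [e1, e2]
    obtain ⟨ρ, hρ, hρ1, hρ4⟩ : ∃ ρ : ℝ, 0 < ρ ∧ ρ < 1 ∧ ρ ^ 4 = 2⁻¹ := by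
      refine ⟨(2⁻¹ : ℝ) ^ ((4:ℝ)⁻¹), by positivity, ?_, ?_⟩
      · exact Real.rpow_lt_one (by norm_num) (by norm_num) (by norm_num)
      · rw [← Real.rpow_natCast, ← Real.rpow_mul (by norm_num)]; norm_num
    have mG : ∀ {Ω : Type _} [MeasurableSpace Ω] (Z : ℝ → Ω → E) (hZm : ∀ t, Measurable (Z t))
        (k : ℕ), Measurable fun ω => gridInterp hT (2 ^ k) fun i => Z (T * (i : ℕ) / 2 ^ k) ω :=
      fun Z hZm k =>
        (continuous_gridInterp hT _).measurable.comp (measurable_pi_lambda _ fun i => hZm _)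
    have mG' := fun k : ℕ => (continuous_gridInterp (E := E) hT (2 ^ k)).measurable.comp
      (measurable_pi_lambda _ fun i : Fin (2 ^ k + 1) => hWm (T * (i : ℕ) / 2 ^ k))
    have hbd : Tendsto (fun k : ℕ => L * ((1 + C * T ^ 2) * ρ ^ k * (1 - ρ)⁻¹)) atTop (𝓝 0) := by
      simpa using (((tendsto_pow_atTop_nhds_zero_of_lt_one hρ.le hρ1).const_mul
        (1 + C * T ^ 2)).mul_const (1 - ρ)⁻¹).const_mul (L : ℝ)
    have hpos : ∀ k : ℕ, 0 ≤ (1 + C * T ^ 2) * ρ ^ k * (1 - ρ)⁻¹ := fun k => by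
      have : 0 < 1 - ρ := by linarith
      positivity
    rw [Metric.tendsto_nhds]
    intro δ hδ
    obtain ⟨k, hk⟩ := (hbd.eventually_lt_const (show 0 < δ / 3 by positivity)).exists
    obtain ⟨x₀⟩ : Nonempty C(Set.Icc (0:ℝ) T, E) := inferInstance
    let F : BoundedContinuousFunction (Fin (2 ^ k + 1) → E) ℝ :=
      BoundedContinuousFunction.mkOfBound ⟨fun p => f (gridInterp hT (2 ^ k) p),
        hL.continuous.comp (continuous_gridInterp hT _)⟩ K fun x y => hK _ _
    have hF := hfdd (2 ^ k) (fun i => T * (i : ℕ) / 2 ^ k) (fun i => by positivity) F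
    rw [Metric.tendsto_nhds] at hF
    filter_upwards [hF (δ / 3) (by positivity)] with n hn
    have a1 := abs_integral_sub_le_of_lintegral_edist_le P hK hL (mZ n) (mG (Z n) (hZm n) k)
      (hpos k) (lintegral_edist_restrictPath_gridInterp_le P hT hC hρ hρ1 hρ4 (hZ n) (hZm n)
        (hZmom n) k)
    have a2 := abs_integral_sub_le_of_lintegral_edist_le P' hK hL mW (mG' k)
      (hpos k) (lintegral_edist_restrictPath_gridInterp_le P' hT hC hρ hρ1 hρ4 hW hWm hWmom k)
    rw [dist_comm] at a2
    have t1 := dist_triangle4 (∫ ω, f (restrictPath T (fun t => Z n t ω) (hZ n ω)) ∂P)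
      (∫ ω, F (fun i => Z n (T * (i : ℕ) / 2 ^ k) ω) ∂P)
      (∫ ω, F (fun i => W (T * (i : ℕ) / 2 ^ k) ω) ∂P')
      (∫ ω, f (restrictPath T (fun t => W t ω) (hW ω)) ∂P')
    exact lt_of_le_of_lt t1 (by
      refine lt_of_lt_of_eq (add_lt_add (add_lt_add (a1.trans_lt hk) hn) (a2.trans_lt hk)) ?_
      ring)
  rw [ProbabilityMeasure.tendsto_iff_forall_integral_tendsto] at key
  have := key f
  have hfm := f.continuous.measurable
  have e1 : ∀ n, ∫ x, f x ∂(μ n : Measure C(Set.Icc (0:ℝ) T, E))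
      = ∫ ω, f (restrictPath T (fun t => Z n t ω) (hZ n ω)) ∂P := fun n =>
    integral_map (mZ n).aemeasurable hfm.aestronglyMeasurable
  have e2 : ∫ x, f x ∂(ν : Measure C(Set.Icc (0:ℝ) T, E))
      = ∫ ω, f (restrictPath T (fun t => W t ω) (hW ω)) ∂P' :=
    integral_map mW.aemeasurable hfm.aestronglyMeasurable
  simpa only [e1, e2] using this

end FunctionalConvergence

section GaussianCharFun

/-- The finite linear combinations of the family `Y` have the characteristic functions of centered
Gaussian variables with covariances `C`. -/
def HasGaussCharFun {Ω S : Type*} [MeasurableSpace Ω] (P : Measure Ω) (Y : S → Ω → ℝ)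
    (C : S → S → ℝ) : Prop :=
  ∀ (ι : Type) [Fintype ι] (c : ι → ℝ) (s : ι → S),
    ∫ ω, Complex.exp ((∑ i, c i * Y (s i) ω : ℝ) * Complex.I) ∂P
      = ((Real.exp (-(∑ i, ∑ k, c i * c k * C (s i) (s k)) / 2) : ℝ) : ℂ)

variable {Ω S : Type*} [MeasurableSpace Ω] {P : Measure Ω} [IsProbabilityMeasure P]

lemma hasGaussCharFun_of_map_eq {Y : S → Ω → ℝ} {C : S → S → ℝ} (hm : ∀ s, Measurable (Y s))
    (h0 : ∀ s, ∫ ω, Y s ω ∂P = 0)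
    (hC : ∀ s t, ∫ ω, Y s ω * Y t ω ∂P = C s t)
    (hg : ∀ (n : ℕ) (c : Fin n → ℝ) (s : Fin n → S), ∃ (m : ℝ) (σ2 : NNReal),
      P.map (fun ω => ∑ i, c i * Y (s i) ω) = ProbabilityTheory.gaussianReal m σ2) :
    HasGaussCharFun P Y C := by
  have hL2 : ∀ s, MemLp (Y s) 2 P := by
    intro s
    obtain ⟨m, σ2, h⟩ := hg 1 (fun _ => 1) (fun _ => s)
    simp only [Finset.univ_unique, Finset.sum_singleton, one_mul] at h
    have := ProbabilityTheory.memLp_id_gaussianReal' (μ := m) (v := σ2) 2 (by simp)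
    rw [← h, memLp_map_measure_iff aestronglyMeasurable_id (hm s).aemeasurable] at this
    exact this
  intro ι _ c s
  set X : Ω → ℝ := fun ω => ∑ i, c i * Y (s i) ω with hX
  have hXm : Measurable X := Finset.measurable_sum _ fun i _ => (hm _).const_mul _
  obtain ⟨m, σ2, h⟩ : ∃ (m : ℝ) (σ2 : NNReal), P.map X = ProbabilityTheory.gaussianReal m σ2 := by
    obtain ⟨m, σ2, h⟩ := hg (Fintype.card ι) (c ∘ (Fintype.equivFin ι).symm)
      (s ∘ (Fintype.equivFin ι).symm)
    refine ⟨m, σ2, ?_⟩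
    rw [← h]
    congr 1
    ext ω
    exact ((Fintype.equivFin ι).symm.sum_comp fun i => c i * Y (s i) ω).symm
  have hm0 : m = 0 := by
    have e1 : ∫ ω, X ω ∂P = m := by
      rw [← ProbabilityTheory.integral_id_gaussianReal (μ := m) (v := σ2), ← h]
      exact (integral_map hXm.aemeasurable (f := fun x : ℝ => x) (by fun_prop)).symm
    rw [← e1, hX, integral_finsetSum _ fun i _ => ((hL2 _).integrable (by simp)).const_mul _]
    simp [integral_const_mul, h0]
  subst hm0
  have hσ : (σ2 : ℝ) = ∑ i, ∑ k, c i * c k * C (s i) (s k) := by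
    have e1 : ∫ ω, X ω ^ 2 ∂P = σ2 := by
      have := ProbabilityTheory.variance_id_gaussianReal (μ := 0) (v := σ2)
      rw [ProbabilityTheory.variance_of_integral_eq_zero aemeasurable_id
        (by simp), ← h,
        integral_map hXm.aemeasurable (by fun_prop)] at this
      simpa using this
    have e2 : ∀ ω, X ω ^ 2 = ∑ i, ∑ k, c i * c k * (Y (s i) ω * Y (s k) ω) := by
      intro ω
      rw [hX, sq, Finset.sum_mul_sum]
      exact Finset.sum_congr rfl fun i _ => Finset.sum_congr rfl fun k _ => by ring
    have hi : ∀ i k, Integrable (fun ω => c i * c k * (Y (s i) ω * Y (s k) ω)) P := fun i k =>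
      ((hL2 _).integrable_mul (hL2 _)).const_mul _
    rw [← e1]
    simp only [e2]
    rw [integral_finsetSum _ fun i _ => integrable_finsetSum _ fun k _ => hi i k]
    refine Finset.sum_congr rfl fun i _ => ?_
    rw [integral_finsetSum _ fun k _ => hi i k]
    refine Finset.sum_congr rfl fun k _ => ?_
    rw [integral_const_mul, hC]
  have hc := ProbabilityTheory.charFun_gaussianReal (μ := 0) (v := σ2) 1
  rw [← h, charFun_apply_real, integral_map hXm.aemeasurable (by fun_prop)] at hc
  simp only [Complex.ofReal_one, one_mul] at hc
  rw [hc, ← hσ]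
  push_cast
  congr 1
  ring

lemma HasGaussCharFun.lintegral_pow_four_le {Y : S → Ω → ℝ} {C : S → S → ℝ}
    (h : HasGaussCharFun P Y C) (hm : ∀ s, Measurable (Y s)) (s t : S) {B : ℝ}
    (hB : C s s - C s t - C t s + C t t ≤ B) :
    ∫⁻ ω, ‖Y s ω - Y t ω‖ₑ ^ 4 ∂P ≤
      ENNReal.ofReal (B ^ 2) * ∫⁻ x, ‖x‖ₑ ^ 4 ∂ProbabilityTheory.gaussianReal 0 1 := by
  set V := C s s - C s t - C t s + C t t with hV
  have hch : ∀ θ : ℝ, ∫ ω, Complex.exp ((θ * (Y s ω - Y t ω) : ℝ) * Complex.I) ∂P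
      = ((Real.exp (-(θ ^ 2 * V) / 2) : ℝ) : ℂ) := by
    intro θ
    have := h (Fin 2) ![θ, -θ] ![s, t]
    simp only [Fin.sum_univ_two, Matrix.cons_val_zero, Matrix.cons_val_one] at this
    convert this using 3
    · congr 3; ring
    · congr 2; rw [hV]; ring
  have hV0 : 0 ≤ V := by
    by_contra! hneg
    have h1 := norm_integral_le_integral_norm (μ := P)
      fun ω => Complex.exp ((1 * (Y s ω - Y t ω) : ℝ) * Complex.I)
    simp only [Complex.norm_exp_ofReal_mul_I, hch, integral_const, probReal_univ, smul_eq_mul,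
      mul_one, Complex.norm_real] at h1
    rw [Real.norm_of_nonneg (Real.exp_pos _).le, Real.exp_le_one_iff] at h1
    linarith
  have hXm : Measurable fun ω => Y s ω - Y t ω := (hm s).sub (hm t)
  have hlaw : P.map (fun ω => Y s ω - Y t ω)
      = (ProbabilityTheory.gaussianReal 0 1).map (√V * ·) := by
    rw [ProbabilityTheory.gaussianReal_map_const_mul]
    have := Measure.isProbabilityMeasure_map (μ := P) hXm.aemeasurable
    refine Measure.ext_of_charFun ?_
    ext θ
    rw [charFun_apply_real, integral_map hXm.aemeasurable (by fun_prop),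
      ProbabilityTheory.charFun_gaussianReal]
    have := hch θ
    simp only [Complex.ofReal_mul] at this
    rw [this, Complex.ofReal_exp]
    congr 1
    simp only [NNReal.coe_mul, NNReal.coe_mk, Real.sq_sqrt hV0]
    push_cast
    simp only [mul_zero, zero_mul]
    ring
  calc ∫⁻ ω, ‖Y s ω - Y t ω‖ₑ ^ 4 ∂P
      = ∫⁻ x, ‖x‖ₑ ^ 4 ∂(P.map (fun ω => Y s ω - Y t ω)) :=
        (lintegral_map (f := fun x : ℝ => ‖x‖ₑ ^ 4) (by fun_prop) hXm).symm
    _ = ∫⁻ x, ‖√V * x‖ₑ ^ 4 ∂ProbabilityTheory.gaussianReal 0 1 := by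
        rw [hlaw, lintegral_map (by fun_prop) (by fun_prop)]
    _ = ENNReal.ofReal (V ^ 2) * ∫⁻ x, ‖x‖ₑ ^ 4 ∂ProbabilityTheory.gaussianReal 0 1 := by
        rw [← lintegral_const_mul _ (by fun_prop)]
        refine lintegral_congr fun x => ?_
        rw [enorm_mul, mul_pow, Real.enorm_of_nonneg (Real.sqrt_nonneg _),
          ← ENNReal.ofReal_pow (Real.sqrt_nonneg _),
          show √V ^ 4 = (√V ^ 2) ^ 2 by ring, Real.sq_sqrt hV0]
    _ ≤ _ := by gcongr

lemma lintegral_pow_four_gaussianReal_ne_top :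
    ∫⁻ x, ‖x‖ₑ ^ 4 ∂ProbabilityTheory.gaussianReal 0 1 ≠ ⊤ := by
  have h := (ProbabilityTheory.memLp_id_gaussianReal' (μ := 0) (v := 1) 4 (by simp)).eLpNorm_lt_top
  have := lintegral_rpow_enorm_lt_top_of_eLpNorm_lt_top (by simp) (by simp) h
  simpa using this.ne

end GaussianCharFun

section EqualSpacing

lemma integral_floor_div_eq_sum (g : ℝ → ℝ) {n : ℕ} (hn : 0 < n) :
    ∫ r in (0:ℝ)..1, g (⌊n * r⌋₊ / n) = ∑ i ∈ Finset.range n, (n:ℝ)⁻¹ * g (i / n) := by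
  have hn' : (0:ℝ) < n := by exact_mod_cast hn
  have hEq : ∀ i : ℕ, Set.EqOn (fun _ : ℝ => g (i / n)) (fun r : ℝ => g (⌊n * r⌋₊ / n))
      (Set.uIoo ((i:ℝ) / n) (((i + 1 : ℕ) : ℝ) / n)) := by
    intro i r hr
    rw [Set.uIoo_of_le (by gcongr; simp)] at hr
    have h1 : (i:ℝ) < n * r := by
      have := hr.1; rw [div_lt_iff₀ hn'] at this; linarith
    have h2 : n * r < i + 1 := by
      have := hr.2; rw [lt_div_iff₀ hn'] at this; push_cast at this; linarith
    have : ⌊n * r⌋₊ = i := by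
      rw [Nat.floor_eq_iff (by linarith [(Nat.cast_nonneg i : (0:ℝ) ≤ i)])]
      exact ⟨h1.le, h2⟩
    simp only [this]
  have hs := intervalIntegral.sum_integral_adjacent_intervals (μ := volume)
    (f := fun r : ℝ => g (⌊n * r⌋₊ / n)) (a := fun i : ℕ => (i:ℝ) / n) (n := n)
    fun i _ => IntervalIntegrable.congr_uIoo intervalIntegrable_const (hEq i)
  simp only [Nat.cast_zero, zero_div, div_self hn'.ne'] at hs
  rw [← hs]
  refine Finset.sum_congr rfl fun i _ => ?_
  rw [← intervalIntegral.integral_congr_uIoo (hEq i), intervalIntegral.integral_const, smul_eq_mul]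
  push_cast
  congr 1
  field_simp
  ring

lemma tendsto_floor_mul_div (r : ℝ) (hr : 0 ≤ r) :
    Tendsto (fun n : ℕ => (⌊(n:ℝ) * r⌋₊ : ℝ) / n) atTop (𝓝 r) := by
  have := (tendsto_nat_floor_mul_div_atTop hr).comp tendsto_natCast_atTop_atTop
  simpa [Function.comp_def, mul_comm] using this

lemma floor_mul_div_mem_Icc (n : ℕ) {r : ℝ} (hr : r ∈ Set.Icc (0:ℝ) 1) :
    (⌊(n:ℝ) * r⌋₊ : ℝ) / n ∈ Set.Icc (0:ℝ) 1 := by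
  refine ⟨by positivity, div_le_one_of_le₀ ?_ (by positivity)⟩
  exact (Nat.floor_le (mul_nonneg (by positivity) hr.1)).trans
    (mul_le_of_le_one_right (by positivity) hr.2)

lemma tendsto_sum_equalSpacing {g : ℝ → ℝ} (hg : Continuous g) :
    Tendsto (fun n : ℕ => ∑ i ∈ Finset.range n, (n:ℝ)⁻¹ * g (i / n)) atTop
      (𝓝 (∫ r in (0:ℝ)..1, g r)) := by
  obtain ⟨M, hM⟩ := isCompact_Icc.exists_bound_of_continuousOn (hg.continuousOn (s := Set.Icc 0 1))
  have : Tendsto (fun n : ℕ => ∫ r in (0:ℝ)..1, g (⌊(n:ℝ) * r⌋₊ / n)) atTop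
      (𝓝 (∫ r in (0:ℝ)..1, g r)) := by
    refine intervalIntegral.tendsto_integral_filter_of_dominated_convergence (fun _ => M)
      (Eventually.of_forall fun n => ?_) (Eventually.of_forall fun n => ae_of_all _ fun r hr => ?_)
      intervalIntegrable_const (ae_of_all _ fun r hr => ?_)
    · exact (hg.measurable.comp (by fun_prop)).aestronglyMeasurable
    · rw [Set.uIoc_of_le zero_le_one] at hr
      exact hM _ (floor_mul_div_mem_Icc n ⟨hr.1.le, hr.2⟩)
    · rw [Set.uIoc_of_le zero_le_one] at hr
      exact (hg.tendsto r).comp (tendsto_floor_mul_div r hr.1.le)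
  refine this.congr' ?_
  filter_upwards [eventually_gt_atTop 0] with n hn using integral_floor_div_eq_sum g hn

lemma tendsto_sum_sum_equalSpacing {K : ℝ → ℝ → ℝ} (hK : Continuous (Function.uncurry K)) :
    Tendsto (fun n : ℕ => ∑ i ∈ Finset.range n, ∑ k ∈ Finset.range n,
      (n:ℝ)⁻¹ * (n:ℝ)⁻¹ * K (i / n) (k / n)) atTop
      (𝓝 (∫ r in (0:ℝ)..1, ∫ r' in (0:ℝ)..1, K r r')) := by
  obtain ⟨M, hM⟩ := (isCompact_Icc.prod isCompact_Icc).exists_bound_of_continuousOn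
    (hK.continuousOn (s := Set.Icc 0 1 ×ˢ Set.Icc 0 1))
  have inner : ∀ r ∈ Set.Icc (0:ℝ) 1, Tendsto (fun n : ℕ => ∫ r' in (0:ℝ)..1,
      K (⌊(n:ℝ) * r⌋₊ / n) (⌊(n:ℝ) * r'⌋₊ / n)) atTop (𝓝 (∫ r' in (0:ℝ)..1, K r r')) := by
    intro r hr
    refine intervalIntegral.tendsto_integral_filter_of_dominated_convergence (fun _ => M)
      (Eventually.of_forall fun n => ?_) (Eventually.of_forall fun n => ae_of_all _ fun r' hr' => ?_)
      intervalIntegrable_const (ae_of_all _ fun r' hr' => ?_)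
    · have : Continuous (K (⌊(n:ℝ) * r⌋₊ / n)) := hK.comp (by fun_prop : Continuous fun y =>
        ((⌊(n:ℝ) * r⌋₊ / n : ℝ), y))
      exact (this.measurable.comp (by fun_prop)).aestronglyMeasurable
    · rw [Set.uIoc_of_le zero_le_one] at hr'
      exact hM (_, _) ⟨floor_mul_div_mem_Icc n hr, floor_mul_div_mem_Icc n ⟨hr'.1.le, hr'.2⟩⟩
    · rw [Set.uIoc_of_le zero_le_one] at hr'
      exact (hK.tendsto (r, r')).comp
        ((tendsto_floor_mul_div r hr.1).prodMk_nhds (tendsto_floor_mul_div r' hr'.1.le))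
  have outer : Tendsto (fun n : ℕ => ∫ r in (0:ℝ)..1, ∫ r' in (0:ℝ)..1,
      K (⌊(n:ℝ) * r⌋₊ / n) (⌊(n:ℝ) * r'⌋₊ / n)) atTop
      (𝓝 (∫ r in (0:ℝ)..1, ∫ r' in (0:ℝ)..1, K r r')) := by
    refine intervalIntegral.tendsto_integral_filter_of_dominated_convergence (fun _ => M)
      ?_ (Eventually.of_forall fun n => ae_of_all _ fun r hr => ?_)
      intervalIntegrable_const (ae_of_all _ fun r hr => ?_)
    · filter_upwards [eventually_gt_atTop 0] with n hn
      simp only [integral_floor_div_eq_sum (K _) hn]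
      refine (Finset.measurable_sum _ fun k _ => Measurable.const_mul ?_ _).aestronglyMeasurable
      have : Continuous fun x => K x (k / n) := hK.comp (by fun_prop : Continuous fun x =>
        (x, (k / n : ℝ)))
      exact this.measurable.comp (by fun_prop)
    · rw [Set.uIoc_of_le zero_le_one] at hr
      refine (intervalIntegral.norm_integral_le_of_norm_le_const (C := M) fun r' hr' => ?_).trans_eq
        (by simp)
      rw [Set.uIoc_of_le zero_le_one] at hr'
      exact hM (_, _) ⟨floor_mul_div_mem_Icc n ⟨hr.1.le, hr.2⟩,
        floor_mul_div_mem_Icc n ⟨hr'.1.le, hr'.2⟩⟩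
    · rw [Set.uIoc_of_le zero_le_one] at hr
      exact inner r ⟨hr.1.le, hr.2⟩
  refine outer.congr' ?_
  filter_upwards [eventually_gt_atTop 0] with n hn
  rw [integral_floor_div_eq_sum (fun x => ∫ r' in (0:ℝ)..1, K x (⌊(n:ℝ) * r'⌋₊ / n)) hn]
  refine Finset.sum_congr rfl fun i _ => ?_
  rw [integral_floor_div_eq_sum _ hn, Finset.mul_sum]
  exact Finset.sum_congr rfl fun k _ => by ring

/-- The integral over `[0,1]` of a continuous centered Gaussian process is centered Gaussian. -/
lemma HasGaussCharFun.integral_exp_integral {Ω : Type*} [MeasurableSpace Ω] {P : Measure Ω}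
    [IsProbabilityMeasure P] {Y : ℝ → Ω → ℝ} {K : ℝ → ℝ → ℝ} (h : HasGaussCharFun P Y K)
    (hm : ∀ r, Measurable (Y r)) (hY : ∀ ω, Continuous fun r => Y r ω)
    (hK : Continuous (Function.uncurry K)) :
    ∫ ω, Complex.exp ((∫ r in (0:ℝ)..1, Y r ω : ℝ) * Complex.I) ∂P
      = ((Real.exp (-(∫ r in (0:ℝ)..1, ∫ r' in (0:ℝ)..1, K r r') / 2) : ℝ) : ℂ) := by
  have h1 : Tendsto (fun n : ℕ => ∫ ω, Complex.exp
      ((∑ i ∈ Finset.range n, (n:ℝ)⁻¹ * Y (i / n) ω : ℝ) * Complex.I) ∂P) atTop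
      (𝓝 (∫ ω, Complex.exp ((∫ r in (0:ℝ)..1, Y r ω : ℝ) * Complex.I) ∂P)) := by
    refine tendsto_integral_of_dominated_convergence (fun _ => 1) (fun n => ?_)
      (integrable_const _) (fun n => ae_of_all _ fun ω => ?_) (ae_of_all _ fun ω => ?_)
    · have : Measurable fun ω => ∑ i ∈ Finset.range n, (n:ℝ)⁻¹ * Y (i / n) ω :=
        Finset.measurable_sum _ fun i _ => (hm _).const_mul _
      exact (Complex.measurable_exp.comp
        ((Complex.measurable_ofReal.comp this).mul_const _)).aestronglyMeasurable
    · rw [Complex.norm_exp_ofReal_mul_I]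
    · have hc : Continuous fun x : ℝ => Complex.exp ((x:ℂ) * Complex.I) := by fun_prop
      exact (hc.tendsto _).comp (tendsto_sum_equalSpacing (hY ω))
  have h2 : ∀ n : ℕ, ∫ ω, Complex.exp
      ((∑ i ∈ Finset.range n, (n:ℝ)⁻¹ * Y (i / n) ω : ℝ) * Complex.I) ∂P
      = ((Real.exp (-(∑ i ∈ Finset.range n, ∑ k ∈ Finset.range n,
        (n:ℝ)⁻¹ * (n:ℝ)⁻¹ * K (i / n) (k / n)) / 2) : ℝ) : ℂ) := by
    intro n
    have := h (Fin n) (fun _ => (n:ℝ)⁻¹) (fun i => (i : ℕ) / n)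
    simpa only [Finset.sum_range] using this
  simp only [h2] at h1
  refine tendsto_nhds_unique h1 ?_
  have hc : Continuous fun x : ℝ => ((Real.exp (-x / 2) : ℝ) : ℂ) := by fun_prop
  exact (hc.tendsto _).comp (tendsto_sum_sum_equalSpacing hK)

end EqualSpacing

section Fdd

/-- Convergence of the covariances of centered Gaussian families implies convergence in law of their
finite-dimensional marginals. -/
lemma tendsto_integral_of_hasGaussCharFun {Ω Ω' S : Type*} [MeasurableSpace Ω] [MeasurableSpace Ω']
    {P : Measure Ω} [IsProbabilityMeasure P] {P' : Measure Ω'} [IsProbabilityMeasure P']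
    {Y : ℕ → S → Ω → ℝ} {C : ℕ → S → S → ℝ} {Y' : S → Ω' → ℝ} {C' : S → S → ℝ}
    (hY : ∀ n, HasGaussCharFun P (Y n) (C n)) (hYm : ∀ n s, Measurable (Y n s))
    (hY' : HasGaussCharFun P' Y' C') (hYm' : ∀ s, Measurable (Y' s))
    (hC : ∀ s t, Tendsto (fun n => C n s t) atTop (𝓝 (C' s t)))
    {ι : Type} [Fintype ι] (s : ι → S) (F : BoundedContinuousFunction (ι → ℝ) ℝ) :
    Tendsto (fun n => ∫ ω, F (fun i => Y n (s i) ω) ∂P) atTop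
      (𝓝 (∫ ω, F (fun i => Y' (s i) ω) ∂P')) := by
  have hZm : ∀ n, Measurable fun ω => WithLp.toLp 2 fun i => Y n (s i) ω := fun n =>
    (WithLp.measurable_toLp 2 _).comp (measurable_pi_lambda _ fun i => hYm n _)
  have hZm' : Measurable fun ω => WithLp.toLp 2 fun i => Y' (s i) ω :=
    (WithLp.measurable_toLp 2 _).comp (measurable_pi_lambda _ fun i => hYm' _)
  have hp := fun n => Measure.isProbabilityMeasure_map (μ := P) (hZm n).aemeasurable
  have hp' := Measure.isProbabilityMeasure_map (μ := P') hZm'.aemeasurable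
  let μ : ℕ → ProbabilityMeasure (EuclideanSpace ℝ ι) := fun n => ⟨_, hp n⟩
  let μ' : ProbabilityMeasure (EuclideanSpace ℝ ι) := ⟨_, hp'⟩
  have hconv : Tendsto μ atTop (𝓝 μ') := by
    refine ProbabilityMeasure.tendsto_of_tendsto_charFun fun c => ?_
    have e : ∀ n, charFun (P.map fun ω => WithLp.toLp 2 fun i => Y n (s i) ω) c
        = ((Real.exp (-(∑ i, ∑ k, c i * c k * C n (s i) (s k)) / 2) : ℝ) : ℂ) := by
      intro n
      rw [charFun_apply, integral_map (hZm n).aemeasurable (by fun_prop), ← hY n]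
      simp [PiLp.inner_apply]
    have e' : charFun (P'.map fun ω => WithLp.toLp 2 fun i => Y' (s i) ω) c
        = ((Real.exp (-(∑ i, ∑ k, c i * c k * C' (s i) (s k)) / 2) : ℝ) : ℂ) := by
      rw [charFun_apply, integral_map hZm'.aemeasurable (by fun_prop), ← hY']
      simp [PiLp.inner_apply]
    simp only [μ, μ', ProbabilityMeasure.coe_mk, e, e']
    have hc : Continuous fun x : ℝ => ((Real.exp (-x / 2) : ℝ) : ℂ) := by fun_prop
    exact (hc.tendsto _).comp (tendsto_finsetSum _ fun i _ => tendsto_finsetSum _ fun k _ =>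
      (hC _ _).const_mul _)
  have := (ProbabilityMeasure.tendsto_iff_forall_integral_tendsto.1 hconv)
    (F.compContinuous ⟨_, PiLp.continuous_ofLp 2 _⟩)
  simp only [μ, μ', ProbabilityMeasure.coe_mk] at this
  rw [integral_map hZm'.aemeasurable (by fun_prop)] at this
  simp only [integral_map (hZm _).aemeasurable
    (BoundedContinuousFunction.continuous _).aestronglyMeasurable] at this
  exact this

end Fdd

section CovarianceDecay

variable {γ : ℝ} {L R : ℝ → ℝ}

/-- Potter-type upper bound for a regularly varying function. -/
lemma exists_le_mul_rpow_neg (hLpos : ∀ t > 0, 0 < L t)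
    (hLslow : ∀ s > 0, Tendsto (fun t => L (s * t) / L t) atTop (𝓝 1)) (hRcont : Continuous R)
    (hRL : ∀ t > 0, R t = L t / t ^ γ) {β : ℝ} (hβ : β < γ) :
    ∃ C t₀ : ℝ, 0 < t₀ ∧ ∀ t, t₀ ≤ t → R t ≤ C * t ^ (-β) := by
  have h1 : (1:ℝ) < 2 ^ (γ - β) := Real.one_lt_rpow one_lt_two (by linarith)
  obtain ⟨t₀, ht₀, hle⟩ : ∃ t₀ : ℝ, 0 < t₀ ∧ ∀ t, t₀ ≤ t → L (2 * t) / L t < 2 ^ (γ - β) := by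
    obtain ⟨a, ha⟩ := eventually_atTop.1 ((hLslow 2 two_pos).eventually_lt_const h1)
    exact ⟨max a 1, by positivity, fun t ht => ha t ((le_max_left _ _).trans ht)⟩
  have hdouble : ∀ t, t₀ ≤ t → R (2 * t) * (2 * t) ^ β ≤ R t * t ^ β := by
    intro t ht
    have htpos : 0 < t := ht₀.trans_le ht
    have := (div_lt_iff₀ (hLpos t htpos)).1 (hle t ht)
    rw [hRL _ htpos, hRL _ (by positivity), Real.mul_rpow two_pos.le htpos.le,
      Real.mul_rpow two_pos.le htpos.le, div_mul_eq_mul_div, div_mul_eq_mul_div,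
      div_le_div_iff₀ (by positivity) (by positivity)]
    have e : (2:ℝ) ^ γ = 2 ^ (γ - β) * 2 ^ β := by rw [← Real.rpow_add two_pos]; ring_nf
    rw [e]
    have : L (2 * t) * (2 ^ β * t ^ β * t ^ γ) ≤ 2 ^ (γ - β) * L t * (2 ^ β * t ^ β * t ^ γ) :=
      mul_le_mul_of_nonneg_right this.le (by positivity)
    linarith
  have hcont : ContinuousOn (fun t => R t * t ^ β) (Set.Icc t₀ (2 * t₀)) :=
    hRcont.continuousOn.mul (continuousOn_id.rpow_const fun t ht =>
      Or.inl (ht₀.trans_le ht.1).ne')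
  obtain ⟨C, hC⟩ := isCompact_Icc.bddAbove_image hcont
  have hC' : ∀ t ∈ Set.Icc t₀ (2 * t₀), R t * t ^ β ≤ C := fun t ht =>
    hC (Set.mem_image_of_mem _ ht)
  have key : ∀ n : ℕ, ∀ t, t₀ ≤ t → t ≤ 2 ^ n * t₀ → R t * t ^ β ≤ C := by
    intro n
    induction n with
    | zero => exact fun t h1 h2 => hC' t ⟨h1, by linarith⟩
    | succ n ih =>
      intro t h1 h2
      rcases le_total t (2 * t₀) with h | h
      · exact hC' t ⟨h1, h⟩
      · have := hdouble (t / 2) (by linarith)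
        rw [mul_div_cancel₀ t two_ne_zero] at this
        exact this.trans (ih _ (by linarith) (by rw [pow_succ] at h2; linarith))
  refine ⟨C, t₀, ht₀, fun t ht => ?_⟩
  have htpos : 0 < t := ht₀.trans_le ht
  obtain ⟨n, hn⟩ := pow_unbounded_of_one_lt (t / t₀) one_lt_two
  have := key n t ht (by rw [div_lt_iff₀ ht₀] at hn; exact hn.le)
  rwa [Real.rpow_neg htpos.le, ← div_eq_mul_inv, le_div_iff₀ (by positivity)]

lemma tendsto_atTop_zero_of_slowlyVarying (hγ : 0 < γ) (hLpos : ∀ t > 0, 0 < L t)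
    (hLslow : ∀ s > 0, Tendsto (fun t => L (s * t) / L t) atTop (𝓝 1)) (hRcont : Continuous R)
    (hRL : ∀ t > 0, R t = L t / t ^ γ) : Tendsto R atTop (𝓝 0) := by
  obtain ⟨C, t₀, ht₀, h⟩ := exists_le_mul_rpow_neg hLpos hLslow hRcont hRL (half_lt_self hγ)
  have hlim : Tendsto (fun t : ℝ => C * t ^ (-(γ / 2))) atTop (𝓝 0) := by
    simpa using (tendsto_rpow_neg_atTop (half_pos hγ)).const_mul C
  refine tendsto_of_tendsto_of_tendsto_of_le_of_le' tendsto_const_nhds hlim ?_ ?_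
  · filter_upwards [eventually_gt_atTop 0] with t ht
    rw [hRL t ht]
    have := hLpos t ht
    positivity
  · filter_upwards [eventually_ge_atTop t₀] with t ht using h t ht

lemma exists_tendsto_integral_mul_sin (hγ : 0 < γ) (hLpos : ∀ t > 0, 0 < L t)
    (hLslow : ∀ s > 0, Tendsto (fun t => L (s * t) / L t) atTop (𝓝 1)) (hRcont : Continuous R)
    (hRL : ∀ t > 0, R t = L t / t ^ γ)
    (hLslowinc : γ ≤ 1 → ∃ L' : ℝ → ℝ, (∀ t > 0, HasDerivAt L (L' t) t) ∧
      Tendsto (fun t => t * L' t / L t) atTop (𝓝 0)) :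
    ∃ S, Tendsto (fun x => ∫ z in (0:ℝ)..x, R z * Real.sin z) atTop (𝓝 S) := by
  have hcs : Continuous fun z => R z * Real.sin z := hRcont.mul Real.continuous_sin
  suffices ∃ t₁ S, Tendsto (fun x => ∫ z in t₁..x, R z * Real.sin z) atTop (𝓝 S) by
    obtain ⟨t₁, S, h⟩ := this
    refine ⟨_, (h.const_add (∫ z in (0:ℝ)..t₁, R z * Real.sin z)).congr fun x => ?_⟩
    exact intervalIntegral.integral_add_adjacent_intervals (hcs.intervalIntegrable _ _)
      (hcs.intervalIntegrable _ _)
  have hRpos : ∀ t, 0 < t → 0 ≤ R t := fun t ht => by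
    have := hLpos t ht
    rw [hRL t ht]; positivity
  rcases lt_or_ge 1 γ with h1 | h1
  · obtain ⟨β, hβ1, hβ⟩ := exists_between h1
    obtain ⟨C, t₀, ht₀, h⟩ := exists_le_mul_rpow_neg hLpos hLslow hRcont hRL hβ
    refine ⟨t₀, _, intervalIntegral_tendsto_integral_Ioi (f := fun z => R z * Real.sin z) t₀ ?_
      tendsto_id⟩
    refine ((integrableOn_Ioi_rpow_of_lt (by linarith : -β < -1) ht₀).const_mul C).mono'
      hcs.aestronglyMeasurable ?_
    refine (ae_restrict_iff' measurableSet_Ioi).2 (ae_of_all _ fun t ht => ?_)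
    have ht' : 0 < t := ht₀.trans ht
    rw [norm_mul, Real.norm_of_nonneg (hRpos t ht')]
    exact (mul_le_of_le_one_right (hRpos t ht') (Real.abs_sin_le_one t)).trans (h t (le_of_lt ht))
  · obtain ⟨L', hL', hlim⟩ := hLslowinc h1
    obtain ⟨t₁, ht₁, hlt⟩ : ∃ t₁ : ℝ, 0 < t₁ ∧ ∀ t, t₁ ≤ t → t * L' t / L t < γ := by
      obtain ⟨a, ha⟩ := eventually_atTop.1 (hlim.eventually_lt_const hγ)
      exact ⟨max a 1, by positivity, fun t ht => ha t ((le_max_left _ _).trans ht)⟩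
    set R' : ℝ → ℝ := fun t => L' t * t ^ (-γ) + L t * (-γ * t ^ (-γ - 1)) with hR'
    have hder : ∀ t, 0 < t → HasDerivAt R (R' t) t := by
      intro t ht
      refine ((hL' t ht).mul (Real.hasDerivAt_rpow_const (Or.inl ht.ne'))).congr_of_eventuallyEq ?_
      filter_upwards [lt_mem_nhds ht] with s hs
      rw [hRL s hs, Pi.mul_apply, Real.rpow_neg hs.le, div_eq_mul_inv]
    have hnonpos : ∀ t, t₁ ≤ t → R' t ≤ 0 := by
      intro t ht
      have htpos : 0 < t := ht₁.trans_le ht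
      have := (div_lt_iff₀ (hLpos t htpos)).1 (hlt t ht)
      have e : R' t = (t * L' t - γ * L t) * t ^ (-γ - 1) := by
        have : t ^ (-γ) = t * t ^ (-γ - 1) := by
          rw [Real.rpow_sub_one htpos.ne']; field_simp
        rw [hR']; simp only [this]; ring
      rw [e]
      exact mul_nonpos_of_nonpos_of_nonneg (by linarith) (by positivity)
    have h_int : IntegrableOn R' (Set.Ioi t₁) :=
      integrableOn_Ioi_deriv_of_nonpos hRcont.continuousWithinAt
        (fun t ht => hder t (ht₁.trans ht)) (fun t ht => hnonpos t (le_of_lt ht))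
        (tendsto_atTop_zero_of_slowlyVarying hγ hLpos hLslow hRcont hRL)
    have h_int' : IntegrableOn (fun t => R' t * -Real.cos t) (Set.Ioi t₁) := by
      refine h_int.mul_bdd (c := 1) (by fun_prop) (ae_of_all _ fun t => ?_)
      rw [norm_neg]
      exact Real.abs_cos_le_one t
    have hlimR : Tendsto (fun x => R x * -Real.cos x) atTop (𝓝 0) := by
      refine (tendsto_atTop_zero_of_slowlyVarying hγ hLpos hLslow hRcont
        hRL).zero_mul_isBoundedUnder_le ?_
      refine isBoundedUnder_of ⟨1, fun x => ?_⟩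
      simpa using Real.abs_cos_le_one x
    refine ⟨t₁, _, ((hlimR.sub_const (R t₁ * -Real.cos t₁)).sub
      (intervalIntegral_tendsto_integral_Ioi t₁ h_int' tendsto_id)).congr' ?_⟩
    filter_upwards [eventually_ge_atTop t₁] with x hx
    refine (intervalIntegral.integral_mul_deriv_eq_deriv_mul (u := R) (v := fun x => -Real.cos x)
      (v' := Real.sin) (fun t ht => hder t ?_) (fun t _ => ?_) ?_ ?_).symm
    · rw [Set.uIcc_of_le hx] at ht
      exact ht₁.trans_le ht.1
    · simpa using (Real.hasDerivAt_cos t).fun_neg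
    · rw [intervalIntegrable_iff_integrableOn_Ioc_of_le hx]
      exact h_int.mono_set Set.Ioc_subset_Ioi_self
    · exact Real.continuous_sin.intervalIntegrable _ _

end CovarianceDecay

section TruncatedTransform

/-- The one-sided truncated Fourier transform of `R` at frequency one. -/
noncomputable def truncTransform (R : ℝ → ℝ) (x : ℝ) : ℂ :=
  ∫ z in (0:ℝ)..x, (R z : ℂ) * Complex.exp (z * Complex.I)

variable {R : ℝ → ℝ}

lemma continuous_truncTransform (hR : Continuous R) : Continuous (truncTransform R) :=
  intervalIntegral.continuous_primitive (fun _ _ => Continuous.intervalIntegrable (by fun_prop) _ _)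
    0

lemma truncTransform_eq (hR : Continuous R) (x : ℝ) : truncTransform R x =
    ((∫ z in (0:ℝ)..x, R z * Real.cos z : ℝ) : ℂ)
      + ((∫ z in (0:ℝ)..x, R z * Real.sin z : ℝ) : ℂ) * Complex.I := by
  rw [truncTransform, ← intervalIntegral.integral_ofReal, ← intervalIntegral.integral_ofReal,
    ← intervalIntegral.integral_mul_const, ← intervalIntegral.integral_add
      (Continuous.intervalIntegrable (by fun_prop) _ _)
      (Continuous.intervalIntegrable (by fun_prop) _ _)]
  refine intervalIntegral.integral_congr fun z _ => ?_
  simp only [Complex.exp_mul_I]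
  push_cast
  ring

lemma truncTransform_neg (hR : Continuous R) (heven : ∀ t, R (-t) = R t) (x : ℝ) :
    truncTransform R (-x) = -(starRingEnd ℂ) (truncTransform R x) := by
  have e : ∀ g : ℝ → ℝ, ∫ z in (0:ℝ)..(-x), g z = -∫ z in (0:ℝ)..x, g (-z) := by
    intro g
    rw [intervalIntegral.integral_comp_neg, intervalIntegral.integral_symm, neg_zero]
  rw [truncTransform_eq hR, truncTransform_eq hR, e, e]
  simp only [heven, Real.cos_neg, Real.sin_neg, mul_neg, intervalIntegral.integral_neg]
  simp
  ring

lemma exists_norm_truncTransform_le (hR : Continuous R) (heven : ∀ t, R (-t) = R t) {κ : ℂ}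
    (h : Tendsto (truncTransform R) atTop (𝓝 κ)) : ∃ B, ∀ x, ‖truncTransform R x‖ ≤ B := by
  obtain ⟨a, ha⟩ := eventually_atTop.1 (h.norm.eventually_le_const (lt_add_one ‖κ‖))
  obtain ⟨M, hM⟩ := (isCompact_Icc (a := (0:ℝ)) (b := a)).exists_bound_of_continuousOn
    (continuous_truncTransform hR).continuousOn
  have hpos : ∀ x, 0 ≤ x → ‖truncTransform R x‖ ≤ max M (‖κ‖ + 1) := by
    intro x hx
    rcases le_total x a with h | h
    · exact (hM x ⟨hx, h⟩).trans (le_max_left _ _)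
    · exact (ha x h).trans (le_max_right _ _)
  refine ⟨max M (‖κ‖ + 1), fun x => ?_⟩
  rcases le_total 0 x with h | h
  · exact hpos x h
  · have := hpos (-x) (by linarith)
    rwa [truncTransform_neg hR heven, norm_neg, RCLike.norm_conj] at this

end TruncatedTransform

section GaussianIntegrals

variable {Ω S : Type*} [MeasurableSpace Ω] {P : Measure Ω} {Y : S → Ω → ℝ} {C : S → S → ℝ}

lemma HasGaussCharFun.comp {T : Type*} (h : HasGaussCharFun P Y C) (τ : T → S) :
    HasGaussCharFun P (fun t => Y (τ t)) (fun t t' => C (τ t) (τ t')) :=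
  fun ι _ c s => h ι c (τ ∘ s)

lemma HasGaussCharFun.sum_mul {T : Type*} {ι : Type} [Fintype ι] (h : HasGaussCharFun P Y C)
    (ψ : ι → T → ℝ) (τ : ι → T → S) :
    HasGaussCharFun P (fun t ω => ∑ i, ψ i t * Y (τ i t) ω)
      (fun t t' => ∑ i, ∑ k, ψ i t * ψ k t' * C (τ i t) (τ k t')) := by
  intro κ _ d u
  have := h (κ × ι) (fun p => d p.1 * ψ p.2 (u p.1)) (fun p => τ p.2 (u p.1))
  convert this using 3
  · rename_i ω
    congr 3
    simp only [Fintype.sum_prod_type, Finset.mul_sum, mul_assoc]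
  · congr 2
    simp only [Fintype.sum_prod_type, Finset.mul_sum]
    refine Finset.sum_congr rfl fun m _ => ?_
    rw [Finset.sum_comm]
    exact Finset.sum_congr rfl fun i _ => Finset.sum_congr rfl fun m' _ =>
      Finset.sum_congr rfl fun k _ => by ring

lemma integral_eq_mul_integral_unit (g : ℝ → ℝ) (t : ℝ) :
    ∫ r in (0:ℝ)..t, g r = ∫ r in (0:ℝ)..1, t * g (t * r) := by
  rw [intervalIntegral.integral_const_mul, intervalIntegral.mul_integral_comp_mul_left]
  simp

/-- Integrals of a continuous centered Gaussian process against continuous weights are jointly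
centered Gaussian. -/
lemma HasGaussCharFun.integral_mul [IsProbabilityMeasure P] {v : ℝ → Ω → ℝ} {K : ℝ → ℝ → ℝ}
    (h : HasGaussCharFun P v K) (hm : ∀ r, Measurable (v r)) (hv : ∀ ω, Continuous fun r => v r ω)
    (hK : Continuous (Function.uncurry K)) (g : S → ℝ → ℝ) (hg : ∀ s, Continuous (g s))
    (t : S → ℝ) :
    HasGaussCharFun P (fun s ω => ∫ r in (0:ℝ)..t s, g s r * v r ω)
      (fun s s' => ∫ r in (0:ℝ)..t s, ∫ r' in (0:ℝ)..t s', g s r * g s' r' * K r r') := by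
  intro ι _ c s
  have hK' : ∀ {α : Type} [TopologicalSpace α] {f₁ f₂ : α → ℝ}, Continuous f₁ → Continuous f₂ →
      Continuous fun x => K (f₁ x) (f₂ x) := fun h₁ h₂ => hK.comp (h₁.prodMk h₂)
  set ψ : ι → ℝ → ℝ := fun i r => c i * t (s i) * g (s i) (t (s i) * r) with hψ
  have hψc : ∀ i, Continuous (ψ i) := fun i => by
    have := hg (s i)
    fun_prop
  have key := (h.sum_mul ψ fun i r => t (s i) * r).integral_exp_integral
    (fun r => Finset.measurable_sum _ fun i _ => (hm _).const_mul _)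
    (fun ω => continuous_finsetSum _ fun i _ => (hψc i).mul ((hv ω).comp (by fun_prop)))
    (continuous_finsetSum _ fun i _ => continuous_finsetSum _ fun k _ =>
      (((hψc i).comp continuous_fst).mul ((hψc k).comp continuous_snd)).mul
        (hK' (by fun_prop) (by fun_prop)))
  convert key using 3
  · rename_i ω
    congr 3
    have hvc : ∀ i, Continuous fun r => ψ i r * v (t (s i) * r) ω := fun i =>
      (hψc i).mul ((hv ω).comp (by fun_prop : Continuous fun r => t (s i) * r))
    rw [intervalIntegral.integral_finsetSum fun i _ => (hvc i).intervalIntegrable _ _]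
    refine Finset.sum_congr rfl fun i _ => ?_
    change c i * ∫ r in (0:ℝ)..t (s i), g (s i) r * v r ω = _
    rw [integral_eq_mul_integral_unit, ← intervalIntegral.integral_const_mul]
    refine intervalIntegral.integral_congr fun r _ => ?_
    simp only [hψ]
    ring
  · congr 2
    have hc2 : ∀ i k, Continuous (Function.uncurry fun r r' : ℝ =>
        ψ i r * ψ k r' * K (t (s i) * r) (t (s k) * r')) := fun i k =>
      (((hψc i).comp continuous_fst).mul ((hψc k).comp continuous_snd)).mul
        (hK' (by fun_prop) (by fun_prop))
    have hc1 : ∀ i k r, Continuous fun r' : ℝ =>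
        ψ i r * ψ k r' * K (t (s i) * r) (t (s k) * r') := fun i k r =>
      (hc2 i k).comp (by fun_prop : Continuous fun r' : ℝ => (r, r'))
    have hin : ∀ r : ℝ, ∫ r' in (0:ℝ)..1, ∑ i, ∑ k,
        ψ i r * ψ k r' * K (t (s i) * r) (t (s k) * r')
        = ∑ i, ∑ k, ∫ r' in (0:ℝ)..1, ψ i r * ψ k r' * K (t (s i) * r) (t (s k) * r') := by
      intro r
      rw [intervalIntegral.integral_finsetSum fun i _ => (continuous_finsetSum _ fun k _ =>
        hc1 i k r).intervalIntegrable _ _]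
      refine Finset.sum_congr rfl fun i _ => ?_
      rw [intervalIntegral.integral_finsetSum fun k _ => (hc1 i k r).intervalIntegrable _ _]
    have hc0 : ∀ i k, Continuous fun r : ℝ =>
        ∫ r' in (0:ℝ)..1, ψ i r * ψ k r' * K (t (s i) * r) (t (s k) * r') := fun i k =>
      intervalIntegral.continuous_parametric_intervalIntegral_of_continuous' (hc2 i k) 0 1
    simp only [hin]
    rw [intervalIntegral.integral_finsetSum fun i _ => (continuous_finsetSum _ fun k _ =>
        hc0 i k).intervalIntegrable _ _]
    refine Finset.sum_congr rfl fun i _ => ?_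
    rw [intervalIntegral.integral_finsetSum fun k _ => (hc0 i k).intervalIntegrable _ _]
    refine Finset.sum_congr rfl fun k _ => ?_
    rw [integral_eq_mul_integral_unit, ← intervalIntegral.integral_const_mul]
    refine intervalIntegral.integral_congr fun r _ => ?_
    rw [integral_eq_mul_integral_unit, ← intervalIntegral.integral_const_mul,
      ← intervalIntegral.integral_const_mul]
    refine intervalIntegral.integral_congr fun r' _ => ?_
    simp only [hψ]
    ring

end GaussianIntegrals

section OscillatingCovariance

/-- The components of the rotating frame. -/
noncomputable def osc (j : Fin 2) (x : ℝ) : ℝ := ![-Real.sin x, Real.cos x] j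

/-- The phases of the components of the rotating frame. -/
noncomputable def oscPhase (j : Fin 2) : ℂ := ![Complex.I, 1] j

lemma osc_eq_re (j : Fin 2) (x : ℝ) : osc j x = (oscPhase j * Complex.exp (x * Complex.I)).re := by
  fin_cases j <;> simp [osc, oscPhase, Complex.exp_mul_I, Complex.cos_ofReal_re,
    Complex.sin_ofReal_re, Complex.cos_ofReal_im, Complex.sin_ofReal_im]

lemma norm_oscPhase (j : Fin 2) : ‖oscPhase j‖ = 1 := by
  fin_cases j <;> simp [oscPhase]

@[fun_prop]
lemma continuous_osc (j : Fin 2) : Continuous (osc j) := by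
  simp only [funext (osc_eq_re j)]
  fun_prop

lemma abs_osc_le_one (j : Fin 2) (x : ℝ) : |osc j x| ≤ 1 := by
  rw [osc_eq_re]
  refine (Complex.abs_re_le_norm _).trans ?_
  rw [norm_mul, norm_oscPhase, Complex.norm_exp_ofReal_mul_I, one_mul]

lemma tendsto_integral_osc_mul_osc (j k : Fin 2) (m : ℝ) :
    Tendsto (fun q : ℝ => ∫ r in (0:ℝ)..m, osc j (q ^ 2 * r) * osc k (q ^ 2 * r)) atTop
      (𝓝 (if j = k then m / 2 else 0)) := by
  have hq : Tendsto (fun q : ℝ => (q ^ 2)⁻¹) atTop (𝓝 0) :=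
    tendsto_inv_atTop_zero.comp (tendsto_pow_atTop two_ne_zero)
  have hbd : ∀ f : ℝ → ℝ, (∃ B, ∀ x, |f x| ≤ B) →
      Tendsto (fun q : ℝ => (q ^ 2)⁻¹ * f (q ^ 2 * m)) atTop (𝓝 0) := by
    rintro f ⟨B, hB⟩
    exact hq.zero_mul_isBoundedUnder_le (isBoundedUnder_of ⟨B, fun x => hB _⟩)
  have hsub : ∀ᶠ q : ℝ in atTop, ∫ r in (0:ℝ)..m, osc j (q ^ 2 * r) * osc k (q ^ 2 * r)
      = (q ^ 2)⁻¹ * ∫ x in (0:ℝ)..q ^ 2 * m, osc j x * osc k x := by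
    filter_upwards [eventually_gt_atTop 0] with q hq
    have := intervalIntegral.integral_comp_mul_left (a := 0) (b := m)
      (fun x => osc j x * osc k x) (pow_pos hq 2).ne'
    simpa using this
  have hcs : ∃ B : ℝ, ∀ x, |Real.cos x * Real.sin x / 2| ≤ B := by
    refine ⟨1, fun x => ?_⟩
    rw [abs_div, abs_mul, abs_two]
    have h1 := Real.abs_cos_le_one x
    have h2 := Real.abs_sin_le_one x
    nlinarith [abs_nonneg (Real.cos x), abs_nonneg (Real.sin x)]
  have hss : ∃ B : ℝ, ∀ x, |-(Real.sin x ^ 2) / 2| ≤ B := by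
    refine ⟨1, fun x => ?_⟩
    rw [abs_le]
    constructor <;> nlinarith [Real.sin_sq_add_cos_sq x, sq_nonneg (Real.sin x),
      sq_nonneg (Real.cos x)]
  refine Tendsto.congr' (hsub.mono fun _ h => h.symm) ?_
  have h4 : j = 0 ∧ k = 0 ∨ j = 0 ∧ k = 1 ∨ j = 1 ∧ k = 0 ∨ j = 1 ∧ k = 1 := by
    fin_cases j <;> fin_cases k <;> simp
  rcases h4 with ⟨rfl, rfl⟩ | ⟨rfl, rfl⟩ | ⟨rfl, rfl⟩ | ⟨rfl, rfl⟩
  · have := (hbd _ hcs).const_sub (m / 2)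
    rw [sub_zero] at this
    rw [if_pos rfl]
    refine this.congr' ?_
    filter_upwards [eventually_gt_atTop 0] with q hq
    simp only [osc, Matrix.cons_val_zero, ← sq]
    simp
    field_simp
    ring
  · have := hbd _ hss
    rw [if_neg (by decide)]
    refine this.congr fun q => ?_
    simp only [osc, Matrix.cons_val_zero, Matrix.cons_val_one, neg_mul,
      intervalIntegral.integral_neg, integral_sin_mul_cos₁]
    simp
    ring
  · have := hbd _ hss
    rw [if_neg (by decide)]
    refine this.congr fun q => ?_
    simp only [osc, Matrix.cons_val_zero, Matrix.cons_val_one, mul_comm (Real.cos _), neg_mul,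
      intervalIntegral.integral_neg, integral_sin_mul_cos₁]
    simp
    ring
  · have := (hbd _ hcs).const_add (m / 2)
    rw [add_zero] at this
    rw [if_pos rfl]
    refine this.congr' ?_
    filter_upwards [eventually_gt_atTop 0] with q hq
    simp only [osc, Matrix.cons_val_one, ← sq]
    simp
    field_simp
    ring

end OscillatingCovariance

section ForcedCovariance

variable {R : ℝ → ℝ}

/-- The covariance at times `a`, `b` of the components `j`, `k` of the rescaled forcing, seen in the
rotating frame. -/
noncomputable def forcedCov (R : ℝ → ℝ) (q : ℝ) (j k : Fin 2) (a b : ℝ) : ℝ :=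
  ∫ r in (0:ℝ)..a, ∫ r' in (0:ℝ)..b, (osc j (q ^ 2 * r) * q) * (osc k (q ^ 2 * r') * q) *
    R (q ^ 2 * r - q ^ 2 * r')

/-- The increment of `truncTransform R` that governs the inner integral of `forcedCov`. -/
noncomputable def truncIncr (R : ℝ → ℝ) (q b r : ℝ) : ℂ :=
  truncTransform R (q ^ 2 * (b - r)) - truncTransform R (-(q ^ 2 * r))

lemma continuous_truncIncr (hR : Continuous R) (q b : ℝ) : Continuous (truncIncr R q b) := by
  have := continuous_truncTransform hR
  unfold truncIncr
  fun_prop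

lemma norm_truncIncr_sub_le {B : ℝ} (hB : ∀ x, ‖truncTransform R x‖ ≤ B) (q a b r : ℝ) :
    ‖truncIncr R q a r - truncIncr R q b r‖ ≤ 2 * B := by
  rw [truncIncr, truncIncr, sub_sub_sub_cancel_right, two_mul]
  exact (norm_sub_le _ _).trans (add_le_add (hB _) (hB _))

lemma integral_osc_mul_eq (hR : Continuous R) (heven : ∀ t, R (-t) = R t) (k : Fin 2)
    (q b r : ℝ) :
    ∫ r' in (0:ℝ)..b, q ^ 2 * osc k (q ^ 2 * r') * R (q ^ 2 * r - q ^ 2 * r')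
      = (oscPhase k * Complex.exp ((q ^ 2 * r : ℝ) * Complex.I) * truncIncr R q b r).re := by
  have hi : ∀ a b : ℝ, IntervalIntegrable
      (fun z : ℝ => (R z : ℂ) * Complex.exp (z * Complex.I)) volume a b := fun a b =>
    Continuous.intervalIntegrable (by fun_prop) _ _
  have e1 : ∫ r' in (0:ℝ)..b, q ^ 2 * osc k (q ^ 2 * r') * R (q ^ 2 * r - q ^ 2 * r')
      = ∫ z in -(q ^ 2 * r)..q ^ 2 * (b - r), osc k (z + q ^ 2 * r) * R z := by
    have := intervalIntegral.mul_integral_comp_mul_sub (a := 0) (b := b)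
      (f := fun z => osc k (z + q ^ 2 * r) * R z) (q ^ 2) (q ^ 2 * r)
    rw [mul_zero, zero_sub, ← mul_sub] at this
    rw [← this, ← intervalIntegral.integral_const_mul]
    refine intervalIntegral.integral_congr fun r' _ => ?_
    simp only [sub_add_cancel]
    rw [← heven (q ^ 2 * r' - q ^ 2 * r), neg_sub, mul_assoc]
  have e2 : truncIncr R q b r = ∫ z in -(q ^ 2 * r)..q ^ 2 * (b - r),
      (R z : ℂ) * Complex.exp (z * Complex.I) :=
    intervalIntegral.integral_interval_sub_left (hi _ _) (hi _ _)
  rw [e1, e2, ← intervalIntegral.integral_const_mul]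
  have := (Complex.reCLM.intervalIntegral_comp_comm (a := -(q ^ 2 * r)) (b := q ^ 2 * (b - r))
    ((hi _ _).const_mul (oscPhase k * Complex.exp ((q ^ 2 * r : ℝ) * Complex.I))))
  simp only [Complex.reCLM_apply] at this
  rw [← this]
  refine intervalIntegral.integral_congr fun z _ => ?_
  rw [osc_eq_re, mul_comm, ← Complex.re_ofReal_mul]
  congr 1
  push_cast
  rw [add_mul, Complex.exp_add]
  ring

lemma forcedCov_eq (hR : Continuous R) (heven : ∀ t, R (-t) = R t) (q : ℝ) (j k : Fin 2)
    (a b : ℝ) :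
    forcedCov R q j k a b = ∫ r in (0:ℝ)..a, osc j (q ^ 2 * r) *
      (oscPhase k * Complex.exp ((q ^ 2 * r : ℝ) * Complex.I) * truncIncr R q b r).re := by
  refine intervalIntegral.integral_congr fun r _ => ?_
  rw [← integral_osc_mul_eq hR heven, ← intervalIntegral.integral_const_mul]
  refine intervalIntegral.integral_congr fun r' _ => ?_
  ring

lemma continuous_forcedCov_integrand (hR : Continuous R) (q : ℝ) (j k : Fin 2) (b : ℝ) :
    Continuous fun r : ℝ => osc j (q ^ 2 * r) *
      (oscPhase k * Complex.exp ((q ^ 2 * r : ℝ) * Complex.I) * truncIncr R q b r).re := by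
  have := continuous_truncIncr hR q b
  generalize truncIncr R q b = g at this
  fun_prop

lemma abs_osc_mul_re_le (j k : Fin 2) (x y : ℝ) (z : ℂ) :
    |osc j x * (oscPhase k * Complex.exp ((y : ℝ) * Complex.I) * z).re| ≤ ‖z‖ := by
  rw [abs_mul]
  refine (mul_le_of_le_one_left (abs_nonneg _) (abs_osc_le_one _ _)).trans
    ((Complex.abs_re_le_norm _).trans ?_)
  rw [norm_mul, norm_mul, norm_oscPhase, Complex.norm_exp_ofReal_mul_I, one_mul, one_mul]

lemma forcedCov_increment_le (hR : Continuous R) (heven : ∀ t, R (-t) = R t) {B : ℝ}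
    (hB : ∀ x, ‖truncTransform R x‖ ≤ B) (q : ℝ) (j : Fin 2) (s t : ℝ) (hst : s ≤ t) :
    forcedCov R q j j s s - forcedCov R q j j s t - forcedCov R q j j t s + forcedCov R q j j t t
      ≤ 2 * B * (t - s) := by
  have hi : ∀ b c d, IntervalIntegrable (fun r : ℝ => osc j (q ^ 2 * r) *
      (oscPhase j * Complex.exp ((q ^ 2 * r : ℝ) * Complex.I) * truncIncr R q b r).re)
      volume c d := fun b c d =>
    (continuous_forcedCov_integrand hR q j j b).intervalIntegrable _ _
  have e : forcedCov R q j j s s - forcedCov R q j j s t - forcedCov R q j j t s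
      + forcedCov R q j j t t = ∫ r in s..t, osc j (q ^ 2 * r) *
        (oscPhase j * Complex.exp ((q ^ 2 * r : ℝ) * Complex.I) *
          (truncIncr R q t r - truncIncr R q s r)).re := by
    simp only [forcedCov_eq hR heven, mul_sub, Complex.sub_re]
    rw [intervalIntegral.integral_sub (hi _ _ _) (hi _ _ _),
      ← intervalIntegral.integral_interval_sub_left (hi t 0 t) (hi t 0 s),
      ← intervalIntegral.integral_interval_sub_left (hi s 0 t) (hi s 0 s)]
    ring
  rw [e]
  refine (le_abs_self _).trans (((Real.norm_eq_abs _).symm.trans_le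
    (intervalIntegral.norm_integral_le_of_norm_le_const (C := 2 * B) fun r _ => ?_)).trans_eq ?_)
  · exact (abs_osc_mul_re_le _ _ _ _ _).trans (norm_truncIncr_sub_le hB _ _ _ _)
  · rw [abs_of_nonneg (by linarith)]

lemma tendsto_integral_osc_mul_truncIncr (hR : Continuous R) {B : ℝ}
    (hB : ∀ x, ‖truncTransform R x‖ ≤ B) (j k : Fin 2) (b c d ℓ : ℝ)
    (hl : ∀ᵐ r, r ∈ Set.uIoc c d → Tendsto (fun q => truncIncr R q b r) atTop (𝓝 (ℓ : ℂ))) :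
    Tendsto (fun q => (∫ r in c..d, osc j (q ^ 2 * r) *
      (oscPhase k * Complex.exp ((q ^ 2 * r : ℝ) * Complex.I) * truncIncr R q b r).re)
      - ℓ * ∫ r in c..d, osc j (q ^ 2 * r) * osc k (q ^ 2 * r)) atTop (𝓝 0) := by
  have e : ∀ q : ℝ, (∫ r in c..d, osc j (q ^ 2 * r) *
      (oscPhase k * Complex.exp ((q ^ 2 * r : ℝ) * Complex.I) * truncIncr R q b r).re)
      - ℓ * ∫ r in c..d, osc j (q ^ 2 * r) * osc k (q ^ 2 * r)
      = ∫ r in c..d, osc j (q ^ 2 * r) *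
        (oscPhase k * Complex.exp ((q ^ 2 * r : ℝ) * Complex.I) * (truncIncr R q b r - ℓ)).re := by
    intro q
    rw [← intervalIntegral.integral_const_mul, ← intervalIntegral.integral_sub
      ((continuous_forcedCov_integrand hR q j k b).intervalIntegrable _ _)
      (Continuous.intervalIntegrable (by fun_prop) _ _)]
    refine intervalIntegral.integral_congr fun r _ => ?_
    rw [mul_sub, Complex.sub_re, mul_comm _ (ℓ : ℂ), Complex.re_ofReal_mul, ← osc_eq_re]
    ring
  simp only [e]
  have h0 : ∫ r in c..d, (0:ℝ) = 0 := by simp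
  rw [← h0]
  refine intervalIntegral.tendsto_integral_filter_of_dominated_convergence
    (fun _ => 2 * B + ‖(ℓ:ℂ)‖) (Eventually.of_forall fun q => ?_)
    (Eventually.of_forall fun q => ae_of_all _ fun r _ => ?_) intervalIntegrable_const ?_
  · have := continuous_truncIncr hR q b
    generalize truncIncr R q b = g at this
    exact (by fun_prop : Continuous _).aestronglyMeasurable
  · refine (abs_osc_mul_re_le _ _ _ _ _).trans ((norm_sub_le _ _).trans ?_)
    gcongr
    rw [truncIncr, two_mul]
    exact (norm_sub_le _ _).trans (add_le_add (hB _) (hB _))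
  · filter_upwards [hl] with r hr hmem
    have h1 := ((hr hmem).sub_const (ℓ:ℂ)).norm
    rw [sub_self, norm_zero] at h1
    exact squeeze_zero_norm (fun q => abs_osc_mul_re_le _ _ _ _ _) h1

lemma tendsto_truncTransform_atBot (hR : Continuous R) (heven : ∀ t, R (-t) = R t) {κ : ℂ}
    (h : Tendsto (truncTransform R) atTop (𝓝 κ)) :
    Tendsto (truncTransform R) atBot (𝓝 (-(starRingEnd ℂ) κ)) := by
  have := ((Complex.continuous_conj.tendsto κ).comp (h.comp tendsto_neg_atBot_atTop)).neg
  refine this.congr fun x => ?_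
  simp only [Function.comp_apply]
  rw [← truncTransform_neg hR heven, neg_neg]

lemma tendsto_truncIncr_of_lt (hR : Continuous R) (heven : ∀ t, R (-t) = R t) {κ : ℂ}
    (h : Tendsto (truncTransform R) atTop (𝓝 κ)) {b r : ℝ} (hr : 0 < r) (hrb : r < b) :
    Tendsto (fun q => truncIncr R q b r) atTop (𝓝 ((2 * κ.re : ℝ) : ℂ)) := by
  have hq : Tendsto (fun q : ℝ => q ^ 2) atTop atTop := tendsto_pow_atTop two_ne_zero
  have h1 := h.comp (hq.atTop_mul_const (sub_pos.2 hrb))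
  have h2 := (tendsto_truncTransform_atBot hR heven h).comp
    (tendsto_neg_atTop_atBot.comp (hq.atTop_mul_const hr))
  have := h1.sub h2
  rwa [sub_neg_eq_add, Complex.add_conj] at this

lemma tendsto_truncIncr_of_gt (hR : Continuous R) (heven : ∀ t, R (-t) = R t) {κ : ℂ}
    (h : Tendsto (truncTransform R) atTop (𝓝 κ)) {b r : ℝ} (hr : 0 < r) (hrb : b < r) :
    Tendsto (fun q => truncIncr R q b r) atTop (𝓝 ((0 : ℝ) : ℂ)) := by
  have hq : Tendsto (fun q : ℝ => q ^ 2) atTop atTop := tendsto_pow_atTop two_ne_zero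
  have h1 := (tendsto_truncTransform_atBot hR heven h).comp
    (hq.atTop_mul_const_of_neg (sub_neg.2 hrb))
  have h2 := (tendsto_truncTransform_atBot hR heven h).comp
    (tendsto_neg_atTop_atBot.comp (hq.atTop_mul_const hr))
  have := h1.sub h2
  rwa [sub_self, ← Complex.ofReal_zero] at this

lemma tendsto_forcedCov (hR : Continuous R) (heven : ∀ t, R (-t) = R t) {κ : ℂ}
    (h : Tendsto (truncTransform R) atTop (𝓝 κ)) (j k : Fin 2) {a b : ℝ} (ha : 0 ≤ a)
    (hb : 0 ≤ b) :
    Tendsto (fun q => forcedCov R q j k a b) atTop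
      (𝓝 (if j = k then κ.re * min a b else 0)) := by
  obtain ⟨B, hB⟩ := exists_norm_truncTransform_le hR heven h
  have hm : 0 ≤ min a b := le_min ha hb
  have h1 := tendsto_integral_osc_mul_truncIncr hR hB j k b 0 (min a b) (2 * κ.re) (by
    filter_upwards [compl_mem_ae_iff.2 (measure_singleton b)] with r hne hr
    rw [Set.uIoc_of_le hm] at hr
    exact tendsto_truncIncr_of_lt hR heven h hr.1
      (lt_of_le_of_ne (hr.2.trans (min_le_right _ _)) hne))
  have h2 := tendsto_integral_osc_mul_truncIncr hR hB j k b (min a b) a 0 (by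
    refine ae_of_all _ fun r hr => ?_
    rw [Set.uIoc_of_le (min_le_left _ _)] at hr
    refine tendsto_truncIncr_of_gt hR heven h (hm.trans_lt hr.1) ?_
    rcases min_lt_iff.1 hr.1 with h' | h'
    · exact absurd hr.2 h'.not_ge
    · exact h')
  have h3 := (tendsto_integral_osc_mul_osc j k (min a b)).const_mul (2 * κ.re)
  have := (h1.add h2).add h3
  have elim : (0:ℝ) + 0 + 2 * κ.re * (if j = k then min a b / 2 else 0)
      = if j = k then κ.re * min a b else 0 := by
    split_ifs <;> ring
  rw [elim] at this
  refine this.congr fun q => ?_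
  have hi := fun c d => (continuous_forcedCov_integrand hR q j k b).intervalIntegrable
    (μ := volume) c d
  rw [forcedCov_eq hR heven, ← intervalIntegral.integral_add_adjacent_intervals
    (hi 0 (min a b)) (hi (min a b) a)]
  ring

end ForcedCovariance

section PlanarProcesses

lemma continuous_coord2 (j : Fin 2) : Continuous (coord2 j) := by
  fin_cases j
  · exact continuous_fst
  · exact continuous_snd

variable {Ω Ω' : Type*} [MeasurableSpace Ω] [MeasurableSpace Ω']
  {P : Measure Ω} [IsProbabilityMeasure P] {P' : Measure Ω'} [IsProbabilityMeasure P']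

lemma lintegral_edist_pow_four_le {Z : ℝ → Ω → ℝ × ℝ} {X₀ : ℝ × ℝ} (hZm : ∀ t, Measurable (Z t))
    {C : Fin 2 × NNReal → Fin 2 × NNReal → ℝ}
    (hG : HasGaussCharFun P (fun s ω => coord2 s.1 (Z s.2 ω) - coord2 s.1 X₀) C) {B : ℝ}
    (hB : ∀ j (s t : NNReal), s ≤ t →
      C (j, s) (j, s) - C (j, s) (j, t) - C (j, t) (j, s) + C (j, t) (j, t) ≤ B * (t - s))
    {s t : ℝ} (hs : 0 ≤ s) (hst : s ≤ t) :
    ∫⁻ ω, edist (Z s ω) (Z t ω) ^ 4 ∂P ≤ ENNReal.ofReal (2 * B ^ 2 *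
      (∫⁻ x, ‖x‖ₑ ^ 4 ∂ProbabilityTheory.gaussianReal 0 1).toReal * (t - s) ^ 2) := by
  have hcm : ∀ (j : Fin 2) (t : ℝ), Measurable fun ω => coord2 j (Z t ω) := fun j t =>
    (continuous_coord2 j).measurable.comp (hZm t)
  have key : ∀ j : Fin 2, ∫⁻ ω, ‖coord2 j (Z s ω) - coord2 j (Z t ω)‖ₑ ^ 4 ∂P ≤
      ENNReal.ofReal ((B * (t - s)) ^ 2) *
        ∫⁻ x, ‖x‖ₑ ^ 4 ∂ProbabilityTheory.gaussianReal 0 1 := by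
    intro j
    have := hG.lintegral_pow_four_le (fun u => (hcm u.1 u.2).sub_const _) (j, ⟨s, hs⟩)
      (j, ⟨t, hs.trans hst⟩) (hB j ⟨s, hs⟩ ⟨t, hs.trans hst⟩ hst)
    simp only [sub_sub_sub_cancel_right] at this
    exact this
  calc ∫⁻ ω, edist (Z s ω) (Z t ω) ^ 4 ∂P
      ≤ ∫⁻ ω, (‖coord2 0 (Z s ω) - coord2 0 (Z t ω)‖ₑ ^ 4
        + ‖coord2 1 (Z s ω) - coord2 1 (Z t ω)‖ₑ ^ 4) ∂P := by
        refine lintegral_mono fun ω => ?_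
        simp only [coord2, Matrix.cons_val_zero, Matrix.cons_val_one, ← edist_eq_enorm_sub,
          Prod.edist_eq]
        rcases max_choice (edist (Z s ω).1 (Z t ω).1) (edist (Z s ω).2 (Z t ω).2) with h | h
        · rw [h]; exact le_self_add
        · rw [h]; exact le_add_self
    _ ≤ ENNReal.ofReal ((B * (t - s)) ^ 2) *
          ∫⁻ x, ‖x‖ₑ ^ 4 ∂ProbabilityTheory.gaussianReal 0 1
        + ENNReal.ofReal ((B * (t - s)) ^ 2) *
          ∫⁻ x, ‖x‖ₑ ^ 4 ∂ProbabilityTheory.gaussianReal 0 1 := by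
        have h0 : Measurable fun ω => coord2 0 (Z s ω) - coord2 0 (Z t ω) := (hcm 0 s).sub (hcm 0 t)
        rw [lintegral_add_left (h0.enorm.pow_const 4)]
        exact add_le_add (key 0) (key 1)
    _ = _ := by
        rw [← two_mul]
        conv_lhs => rw [← ENNReal.ofReal_toReal lintegral_pow_four_gaussianReal_ne_top]
        rw [← ENNReal.ofReal_mul (by positivity), ← ENNReal.ofReal_ofNat,
          ← ENNReal.ofReal_mul (by positivity)]
        congr 1
        ring

/-- Functional convergence of planar centered Gaussian processes started at a common point, from
convergence of the covariances and a uniform Lipschitz bound on the variances of the increments. -/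
lemma tendsto_integral_restrictPath_of_hasGaussCharFun {X₀ : ℝ × ℝ} {T : ℝ} (hT : 0 < T)
    {Z : ℕ → ℝ → Ω → ℝ × ℝ} (hZ : ∀ n ω, Continuous fun t => Z n t ω)
    (hZm : ∀ n t, Measurable (Z n t)) {C : ℕ → Fin 2 × NNReal → Fin 2 × NNReal → ℝ}
    (hZG : ∀ n, HasGaussCharFun P (fun s ω => coord2 s.1 (Z n s.2 ω) - coord2 s.1 X₀) (C n))
    {W : ℝ → Ω' → ℝ × ℝ} (hW : ∀ ω, Continuous fun t => W t ω) (hWm : ∀ t, Measurable (W t))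
    {C' : Fin 2 × NNReal → Fin 2 × NNReal → ℝ}
    (hWG : HasGaussCharFun P' (fun s ω => coord2 s.1 (W s.2 ω) - coord2 s.1 X₀) C')
    (hlim : ∀ s t, Tendsto (fun n => C n s t) atTop (𝓝 (C' s t))) {B : ℝ}
    (hB : ∀ n j (s t : NNReal), s ≤ t → C n (j, s) (j, s) - C n (j, s) (j, t) - C n (j, t) (j, s)
      + C n (j, t) (j, t) ≤ B * (t - s))
    (f : BoundedContinuousFunction C(Set.Icc (0:ℝ) T, ℝ × ℝ) ℝ) :
    Tendsto (fun n => ∫ ω, f (restrictPath T (fun t => Z n t ω) (hZ n ω)) ∂P) atTop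
      (𝓝 (∫ ω, f (restrictPath T (fun t => W t ω) (hW ω)) ∂P')) := by
  have hB' : ∀ j (s t : NNReal), s ≤ t → C' (j, s) (j, s) - C' (j, s) (j, t) - C' (j, t) (j, s)
      + C' (j, t) (j, t) ≤ B * (t - s) := fun j s t hst =>
    le_of_tendsto' ((((hlim _ _).sub (hlim _ _)).sub (hlim _ _)).add (hlim _ _))
      fun n => hB n j s t hst
  refine tendsto_integral_restrictPath_of_fdd P P' hT (by positivity) hZ hZm
    (fun n s t hs hst _ => lintegral_edist_pow_four_le (hZm n) (hZG n) (hB n) hs hst) hW hWm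
    (fun s t hs hst _ => lintegral_edist_pow_four_le hWm hWG hB' hs hst) (fun N τ hτ F => ?_) f
  have hYm : ∀ (Z : Ω → ℝ × ℝ) (j : Fin 2), Measurable Z →
      Measurable fun ω => coord2 j (Z ω) - coord2 j X₀ := fun Z j hZ =>
    ((continuous_coord2 j).measurable.comp hZ).sub_const _
  have hYm' : ∀ (Z : Ω' → ℝ × ℝ) (j : Fin 2), Measurable Z →
      Measurable fun ω => coord2 j (Z ω) - coord2 j X₀ := fun Z j hZ =>
    ((continuous_coord2 j).measurable.comp hZ).sub_const _
  have := tendsto_integral_of_hasGaussCharFun hZG (fun n s => hYm _ _ (hZm n _)) hWG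
    (fun s => hYm' _ _ (hWm _)) hlim (fun p : Fin (N + 1) × Fin 2 => (p.2, ⟨τ p.1, hτ p.1⟩))
    (F.compContinuous ⟨fun y i => (y (i, 0) + X₀.1, y (i, 1) + X₀.2), by fun_prop⟩)
  simp only [BoundedContinuousFunction.compContinuous_apply, ContinuousMap.coe_mk, coord2,
    Matrix.cons_val_zero, Matrix.cons_val_one, sub_add_cancel, Prod.mk.eta] at this
  exact this

end PlanarProcesses

section RotatingFrame

/-- The rotation of the plane by the angle `θ`. -/
noncomputable def rotate (θ : ℝ) (p : ℝ × ℝ) : ℝ × ℝ :=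
  (Real.cos θ * p.1 - Real.sin θ * p.2, Real.sin θ * p.1 + Real.cos θ * p.2)

lemma quadH_rotate (θ : ℝ) (p : ℝ × ℝ) : quadH (rotate θ p) = quadH p := by
  have h := Real.sin_sq_add_cos_sq θ
  simp only [quadH, rotate]
  linear_combination (p.1 ^ 2 + p.2 ^ 2) / 2 * h

@[fun_prop]
lemma Continuous.rotate {α : Type*} [TopologicalSpace α] {θ : α → ℝ} {g : α → ℝ × ℝ}
    (hθ : Continuous θ) (hg : Continuous g) : Continuous fun x => rotate (θ x) (g x) := by
  unfold _root_.rotate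
  fun_prop

/-- In the rotating frame the forced oscillator is the integral of the rotated forcing. -/
lemma coord2_rotate_sub_eq_integral {q : ℝ} {v : ℝ → ℝ} (hv : Continuous v) {X : ℝ → ℝ × ℝ}
    (hX : ∀ t, 0 ≤ t → HasDerivAt X (q ^ 2 • (((X t).2, -(X t).1) : ℝ × ℝ)
      + (q * v (q ^ 2 * t)) • (((0:ℝ), (1:ℝ)) : ℝ × ℝ)) t) (j : Fin 2) {t : ℝ} (ht : 0 ≤ t) :
    coord2 j (rotate (q ^ 2 * t) (X t)) - coord2 j (X 0)
      = ∫ r in (0:ℝ)..t, (osc j (q ^ 2 * r) * q) * v (q ^ 2 * r) := by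
  have hder : ∀ r, 0 ≤ r → HasDerivAt (fun r => coord2 j (rotate (q ^ 2 * r) (X r)))
      ((osc j (q ^ 2 * r) * q) * v (q ^ 2 * r)) r := by
    intro r hr
    have h1 : HasDerivAt (fun r => (X r).1) (q ^ 2 * (X r).2) r := by
      have := (ContinuousLinearMap.fst ℝ ℝ ℝ).hasFDerivAt.comp_hasDerivAt r (hX r hr)
      exact this.congr_deriv (by simp)
    have h2 : HasDerivAt (fun r => (X r).2) (-(q ^ 2 * (X r).1) + q * v (q ^ 2 * r)) r := by
      have := (ContinuousLinearMap.snd ℝ ℝ ℝ).hasFDerivAt.comp_hasDerivAt r (hX r hr)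
      exact this.congr_deriv (by simp)
    have hθ : HasDerivAt (fun r => q ^ 2 * r) (q ^ 2) r := by
      simpa using (hasDerivAt_id r).const_mul (q ^ 2)
    have hj : j = 0 ∨ j = 1 := by fin_cases j <;> simp
    rcases hj with rfl | rfl
    · refine HasDerivAt.congr_deriv ((hθ.cos.fun_mul h1).fun_sub (hθ.sin.fun_mul h2)) ?_
      simp only [osc, Matrix.cons_val_zero]
      ring
    · refine HasDerivAt.congr_deriv ((hθ.sin.fun_mul h1).fun_add (hθ.cos.fun_mul h2)) ?_
      simp only [osc, Matrix.cons_val_one, Matrix.cons_val_fin_one]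
      ring
  have h0 : rotate (q ^ 2 * 0) (X 0) = X 0 := by simp [rotate]
  rw [intervalIntegral.integral_eq_sub_of_hasDerivAt
    (f := fun r => coord2 j (rotate (q ^ 2 * r) (X r))) (fun r hr => ?_)
    (Continuous.intervalIntegrable (by fun_prop) _ _), h0]
  rw [Set.uIcc_of_le ht] at hr
  exact hder r hr.1

/-- In the rotating frame an oscillator forced by a stationary Gaussian process is a Gaussian
process. -/
lemma hasGaussCharFun_rotate {Ω : Type*} [MeasurableSpace Ω] {P : Measure Ω}
    [IsProbabilityMeasure P] {R : ℝ → ℝ} (hR : Continuous R) {v : ℝ → Ω → ℝ}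
    (hvm : ∀ r, Measurable (v r)) (hv : ∀ ω, Continuous fun r => v r ω)
    (hG : HasGaussCharFun P v fun s t => R (s - t)) {q : ℝ} {X₀ : ℝ × ℝ} {X : ℝ → Ω → ℝ × ℝ}
    (hX₀ : ∀ ω, X 0 ω = X₀)
    (hX : ∀ ω t, 0 ≤ t → HasDerivAt (fun t => X t ω)
      (q ^ 2 • (((X t ω).2, -(X t ω).1) : ℝ × ℝ)
        + (q * v (q ^ 2 * t) ω) • (((0:ℝ), (1:ℝ)) : ℝ × ℝ)) t) :
    HasGaussCharFun P
      (fun (s : Fin 2 × NNReal) ω => coord2 s.1 (rotate (q ^ 2 * s.2) (X s.2 ω)) - coord2 s.1 X₀)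
      (fun s t => forcedCov R q s.1 t.1 s.2 t.2) := by
  have h := (hG.comp fun r : ℝ => q ^ 2 * r).integral_mul (fun r => hvm _)
    (fun ω => (hv ω).comp (continuous_const_mul (q ^ 2))) (by fun_prop)
    (fun (s : Fin 2 × NNReal) r => osc s.1 (q ^ 2 * r) * q) (fun s => by fun_prop)
    (fun s => (s.2 : ℝ))
  have heq : (fun (s : Fin 2 × NNReal) ω =>
      coord2 s.1 (rotate (q ^ 2 * s.2) (X s.2 ω)) - coord2 s.1 X₀)
      = fun s ω => ∫ r in (0:ℝ)..s.2, osc s.1 (q ^ 2 * r) * q * v (q ^ 2 * r) ω := by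
    ext s ω
    have := coord2_rotate_sub_eq_integral (X := fun t => X t ω) (hv ω) (hX ω) s.1 s.2.2
    rwa [hX₀] at this
  rw [heq]
  exact h

/-- Convergence in law of the energy of planar processes that become Gaussian with convergent
covariances in a rotating frame. -/
lemma tendsto_integral_restrictPath_quadH {Ω Ω' : Type*} [MeasurableSpace Ω] [MeasurableSpace Ω']
    {P : Measure Ω} [IsProbabilityMeasure P] {P' : Measure Ω'} [IsProbabilityMeasure P']
    {X₀ : ℝ × ℝ} {T : ℝ} (hT : 0 < T) {X : ℕ → ℝ → Ω → ℝ × ℝ}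
    (hX : ∀ n ω, Continuous fun t => X n t ω) (hXm : ∀ n t, Measurable (X n t)) (a : ℕ → ℝ)
    {C : ℕ → Fin 2 × NNReal → Fin 2 × NNReal → ℝ}
    (hXG : ∀ n, HasGaussCharFun P
      (fun s ω => coord2 s.1 (rotate (a n * s.2) (X n s.2 ω)) - coord2 s.1 X₀) (C n))
    {W : ℝ → Ω' → ℝ × ℝ} (hW : ∀ ω, Continuous fun t => W t ω) (hWm : ∀ t, Measurable (W t))
    {C' : Fin 2 × NNReal → Fin 2 × NNReal → ℝ}
    (hWG : HasGaussCharFun P' (fun s ω => coord2 s.1 (W s.2 ω) - coord2 s.1 X₀) C')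
    (hlim : ∀ s t, Tendsto (fun n => C n s t) atTop (𝓝 (C' s t))) {B : ℝ}
    (hB : ∀ n j (s t : NNReal), s ≤ t → C n (j, s) (j, s) - C n (j, s) (j, t) - C n (j, t) (j, s)
      + C n (j, t) (j, t) ≤ B * (t - s))
    (f : BoundedContinuousFunction C(Set.Icc (0:ℝ) T, ℝ) ℝ) :
    Tendsto (fun n => ∫ ω, f (restrictPath T (fun t => quadH (X n t ω))
        (quadH_continuous.comp (hX n ω))) ∂P) atTop
      (𝓝 (∫ ω, f (restrictPath T (fun t => quadH (W t ω)) (quadH_continuous.comp (hW ω))) ∂P')) := by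
  have hrot : ∀ n ω, Continuous fun t => rotate (a n * t) (X n t ω) := fun n ω =>
    (continuous_const_mul (a n)).rotate (hX n ω)
  have hmain := tendsto_integral_restrictPath_of_hasGaussCharFun hT hrot
    (fun n t => (continuous_const.rotate continuous_id).measurable.comp (hXm n t))
    hXG hW hWm hWG hlim hB
    (f.compContinuous ⟨_, ContinuousMap.continuous_postcomp ⟨quadH, quadH_continuous⟩⟩)
  have hpath : ∀ n ω, (⟨quadH, quadH_continuous⟩ : C(ℝ × ℝ, ℝ)).comp
      (restrictPath T (fun t => rotate (a n * t) (X n t ω)) (hrot n ω))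
      = restrictPath T (fun t => quadH (X n t ω)) (quadH_continuous.comp (hX n ω)) :=
    fun n ω => ContinuousMap.ext fun t => quadH_rotate _ _
  simp only [BoundedContinuousFunction.compContinuous_apply, ContinuousMap.coe_mk, hpath] at hmain
  exact hmain

end RotatingFrame

/-- Let `H(x) = |x|²/2` be the quadratic Hamiltonian on `ℝ²` and, for `ε > 0`,
let `X^ε` be the pathwise `C¹` solution of
`dX_t^ε/dt = ε⁻²∇⊥H(X_t^ε) + ε⁻¹ v(t/ε²) e₂`, `X_0^ε = X₀`, where `v` is a centered
stationary Gaussian process with covariance `R(t) = L(t)/t^γ`, `L` slowly varying,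
`γ ∈ (0,2)` (with slow-increase condition when `γ ≤ 1`). Then as `ε → 0⁺`, `H(X^ε)`
converges in distribution, in `C([0,T],ℝ)` for every `T > 0`, to `H(W^D)`, where `W^D`
is a 2D Brownian motion with `W₀ = X₀`, independent components and covariance
`E[(W_t−X₀)(W_s−X₀)ᵀ] = (t∧s)·D₁₁·Id₂` with `D₁₁ = lim_{x→∞}∫_0^x R(z)cos(z) dz`. -/
theorem stmt_0
    {Ω : Type*} [MeasurableSpace Ω] (P : Measure Ω) [IsProbabilityMeasure P]
    {Ω' : Type*} [MeasurableSpace Ω'] (P' : Measure Ω') [IsProbabilityMeasure P']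
    (γ : ℝ) (hγ : γ ∈ Set.Ioo (0:ℝ) 2)
    (L : ℝ → ℝ) (hLpos : ∀ t > 0, 0 < L t)
    (hLslow : ∀ s > 0, Tendsto (fun t => L (s * t) / L t) atTop (𝓝 1))
    (R : ℝ → ℝ) (hReven : ∀ t, R (-t) = R t)
    (hRbdd : ∃ M, ∀ t, |R t| ≤ M) (hRcont : Continuous R)
    (hRL : ∀ t > 0, R t = L t / t ^ γ)
    (hLslowinc : γ ≤ 1 → ∃ L' : ℝ → ℝ, (∀ t > 0, HasDerivAt L (L' t) t) ∧
      Tendsto (fun t => t * L' t / L t) atTop (𝓝 0))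
    -- the noise `v`: a jointly measurable centered stationary Gaussian process with
    -- continuous sample paths and covariance `R`
    (v : ℝ → Ω → ℝ)
    (hvmeas : Measurable (Function.uncurry v))
    (hvcont : ∀ ω, Continuous fun t => v t ω)
    (hvcentered : ∀ t, ∫ ω, v t ω ∂P = 0)
    (hvgauss : ∀ (n : ℕ) (c : Fin n → ℝ) (t : Fin n → ℝ),
      ∃ (m : ℝ) (σ2 : NNReal),
        P.map (fun ω => ∑ i, c i * v (t i) ω) = ProbabilityTheory.gaussianReal m σ2)
    (hvcov : ∀ s t : ℝ, ∫ ω, v t ω * v s ω ∂P = R (t - s))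
    -- the solution processes `X^ε` of the rescaled stochastically forced oscillator
    (X₀ : ℝ × ℝ) (X : ℝ → ℝ → Ω → ℝ × ℝ)
    (hXinit : ∀ ε ω, X ε 0 ω = X₀)
    (hXcont : ∀ ε ω, Continuous fun t => X ε t ω)
    (hXmeas : ∀ ε t, Measurable fun ω => X ε t ω)
    (hXode : ∀ ε : ℝ, 0 < ε → ∀ ω, ∀ t : ℝ, 0 ≤ t →
      HasDerivAt (fun t' => X ε t' ω)
        ((ε ^ 2)⁻¹ • (((X ε t ω).2, -(X ε t ω).1) : ℝ × ℝ)
          + (ε⁻¹ * v (t / ε ^ 2) ω) • (((0:ℝ), (1:ℝ)) : ℝ × ℝ)) t)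
    -- `D₁₁` and the limiting Brownian motion `W^D`
    (D : ℝ) (hD : Tendsto (fun x => ∫ z in (0:ℝ)..x, R z * Real.cos z) atTop (𝓝 D))
    (W : ℝ → Ω' → ℝ × ℝ)
    (hWinit : ∀ ω', W 0 ω' = X₀)
    (hWcont : ∀ ω', Continuous fun t => W t ω')
    (hWmeas : ∀ t, Measurable fun ω' => W t ω')
    (hWgauss : ∀ (n : ℕ) (c : Fin n → ℝ) (t : Fin n → ℝ) (j : Fin n → Fin 2),
      ∃ (m : ℝ) (σ2 : NNReal),
        P'.map (fun ω' => ∑ i, c i * (coord2 (j i) (W (t i) ω') - coord2 (j i) X₀))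
          = ProbabilityTheory.gaussianReal m σ2)
    (hWcentered : ∀ t : ℝ, 0 ≤ t → ∀ j : Fin 2,
      ∫ ω', (coord2 j (W t ω') - coord2 j X₀) ∂P' = 0)
    (hWcov : ∀ s t : ℝ, 0 ≤ s → 0 ≤ t → ∀ j k : Fin 2,
      ∫ ω', (coord2 j (W t ω') - coord2 j X₀) * (coord2 k (W s ω') - coord2 k X₀) ∂P'
        = if j = k then D * min t s else 0) :
    -- conclusion: convergence in distribution of `H(X^ε)` to `H(W^D)` in `C([0,T],ℝ)`
    ∀ T : ℝ, 0 < T →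
      ∀ f : BoundedContinuousFunction C(Set.Icc (0:ℝ) T, ℝ) ℝ,
        Tendsto
          (fun ε => ∫ ω, f (restrictPath T (fun t => quadH (X ε t ω))
            (quadH_continuous.comp (hXcont ε ω))) ∂P)
          (𝓝[>] 0)
          (𝓝 (∫ ω', f (restrictPath T (fun t => quadH (W t ω'))
            (quadH_continuous.comp (hWcont ω'))) ∂P')) := by
  intro T hT f
  obtain ⟨S, hS⟩ := exists_tendsto_integral_mul_sin hγ.1 hLpos hLslow hRcont hRL hLslowinc
  have hκ : Tendsto (truncTransform R) atTop (𝓝 ((D : ℂ) + (S : ℂ) * Complex.I)) :=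
    ((((Complex.continuous_ofReal.tendsto D).comp hD).add
      (((Complex.continuous_ofReal.tendsto S).comp hS).mul_const Complex.I))).congr
        fun x => (truncTransform_eq hRcont x).symm
  have hκre : ((D : ℂ) + (S : ℂ) * Complex.I).re = D := by simp
  obtain ⟨B, hB⟩ := exists_norm_truncTransform_le hRcont hReven hκ
  have hvm : ∀ r, Measurable (v r) := fun r => hvmeas.comp measurable_prodMk_left
  have hvG : HasGaussCharFun P v fun s t => R (s - t) :=
    hasGaussCharFun_of_map_eq hvm hvcentered (fun s t => hvcov t s) hvgauss
  have hWG : HasGaussCharFun P'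
      (fun (s : Fin 2 × NNReal) ω => coord2 s.1 (W s.2 ω) - coord2 s.1 X₀)
      (fun s t => if s.1 = t.1 then D * min (s.2 : ℝ) t.2 else 0) :=
    hasGaussCharFun_of_map_eq
      (fun s => ((continuous_coord2 s.1).measurable.comp (hWmeas s.2)).sub_const _)
      (fun s => hWcentered s.2 s.2.2 s.1) (fun s t => hWcov t.2 s.2 t.2.2 s.2.2 s.1 t.1)
      (fun n c s => hWgauss n c (fun i => (s i).2) (fun i => (s i).1))
  have hXG : ∀ ε : ℝ, 0 < ε → HasGaussCharFun P
      (fun (s : Fin 2 × NNReal) ω =>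
        coord2 s.1 (rotate (ε⁻¹ ^ 2 * s.2) (X ε s.2 ω)) - coord2 s.1 X₀)
      (fun s t => forcedCov R ε⁻¹ s.1 t.1 s.2 t.2) := by
    intro ε hε
    refine hasGaussCharFun_rotate hRcont hvm hvcont hvG (hXinit ε) fun ω t ht => ?_
    have := hXode ε hε ω t ht
    rwa [div_eq_inv_mul, ← inv_pow] at this
  refine tendsto_of_seq_tendsto fun e he => ?_
  obtain ⟨N, hN⟩ := eventually_atTop.1 (he.eventually self_mem_nhdsWithin)
  rw [← tendsto_add_atTop_iff_nat N]
  have hpos : ∀ n, 0 < e (n + N) := fun n => hN _ (Nat.le_add_left N n)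
  have hq : Tendsto (fun n => (e (n + N))⁻¹) atTop atTop :=
    tendsto_inv_nhdsGT_zero.comp (he.comp (tendsto_add_atTop_nat N))
  exact tendsto_integral_restrictPath_quadH hT (fun n ω => hXcont (e (n + N)) ω)
    (fun n t => hXmeas (e (n + N)) t) (fun n => (e (n + N))⁻¹ ^ 2) (fun n => hXG _ (hpos n))
    hWcont hWmeas hWG
    (fun s t => by
      have := (tendsto_forcedCov hRcont hReven hκ s.1 t.1 s.2.2 t.2.2).comp hq
      rwa [hκre] at this)
    (fun n j s t hst => forcedCov_increment_le hRcont hReven hB _ j s t hst) f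
end

section
/- For each ε > 0 define w₁^ε(t) = ε⁻¹ ∫_0^t v(τ/ε²) sin(τ/ε²) dτ and w₂^ε(t) = ε⁻¹ ∫_0^t v(τ/ε²) cos(τ/ε²) dτ, and let D₁₁ = lim_{x→∞} ∫_0^x R(z) cos(z) dz. Then for every s, t ≥ 0 and i ∈ {1,2}: lim_{ε→0} E[(w_i^ε(t) − w_i^ε(s))²] = D₁₁|t−s|, and lim_{ε→0} E[(w₁^ε(t) − w₁^ε(s))(w₂^ε(t) − w₂^ε(s))] = 0. -/
open MeasureTheory Filter Topology

theorem memLp_two_of_map_eq_gaussianReal {Ω : Type*} [MeasurableSpace Ω] {P : Measure Ω}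
    {X : Ω → ℝ} (hX : Measurable X) {m : ℝ} {σ2 : NNReal}
    (h : P.map X = ProbabilityTheory.gaussianReal m σ2) : MemLp X 2 P := by
  have := ProbabilityTheory.memLp_id_gaussianReal (μ := m) (v := σ2) 2
  rw [← h, memLp_map_measure_iff aestronglyMeasurable_id hX.aemeasurable] at this
  exact_mod_cast this

theorem integral_mul_intervalIntegral_eq {Ω : Type*} [MeasurableSpace Ω] {P : Measure Ω}
    [IsProbabilityMeasure P] {v : ℝ → Ω → ℝ} (hv : Measurable (Function.uncurry v))
    (hL2 : ∀ t, MemLp (v t) 2 P) {R : ℝ → ℝ}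
    (hcov : ∀ s t : ℝ, ∫ ω, v t ω * v s ω ∂P = R (t - s))
    {φ ψ : ℝ → ℝ} (hφ : Continuous φ) (hψ : Continuous ψ) (hφ1 : ∀ x, |φ x| ≤ 1)
    (hψ1 : ∀ x, |ψ x| ≤ 1) {a b : ℝ} (hab : a ≤ b) :
    ∫ ω, (∫ u in a..b, v u ω * φ u) * (∫ y in a..b, v y ω * ψ y) ∂P =
      ∫ u in a..b, ∫ y in a..b, R (u - y) * (φ u * ψ y) := by
  simp only [intervalIntegral.integral_of_le hab]
  set μ : Measure ℝ := volume.restrict (Set.Ioc a b) with hμ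
  have hmul : ∀ x y, Integrable (fun ω => v x ω * v y ω) P := fun x y =>
    (hL2 x).integrable_mul (hL2 y)
  have hm : Measurable fun q : Ω × (ℝ × ℝ) =>
      v q.2.1 q.1 * φ q.2.1 * (v q.2.2 q.1 * ψ q.2.2) := by
    have h1 : Measurable fun q : Ω × (ℝ × ℝ) => v q.2.1 q.1 :=
      hv.comp (measurable_snd.fst.prodMk measurable_fst)
    have h2 : Measurable fun q : Ω × (ℝ × ℝ) => v q.2.2 q.1 :=
      hv.comp (measurable_snd.snd.prodMk measurable_fst)
    exact (h1.mul (hφ.measurable.comp measurable_snd.fst)).mul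
      (h2.mul (hψ.measurable.comp measurable_snd.snd))
  have hint : Integrable (fun q : Ω × (ℝ × ℝ) =>
      v q.2.1 q.1 * φ q.2.1 * (v q.2.2 q.1 * ψ q.2.2)) (P.prod (μ.prod μ)) := by
    rw [integrable_prod_iff' hm.aestronglyMeasurable]
    refine ⟨.of_forall fun z => ?_, ?_⟩
    · refine ((hmul z.1 z.2).mul_const (φ z.1 * ψ z.2)).congr (.of_forall fun ω => ?_)
      simp only; ring
    · refine Integrable.of_bound
        (hm.norm.comp measurable_swap).aestronglyMeasurable.integral_prod_right' (R 0)
        (.of_forall fun z => ?_)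
      rw [Real.norm_of_nonneg (integral_nonneg fun _ => norm_nonneg _)]
      have hsq : ∀ x, ∫ ω, v x ω * v x ω ∂P = R 0 := fun x => by rw [hcov, sub_self]
      calc ∫ ω, ‖v z.1 ω * φ z.1 * (v z.2 ω * ψ z.2)‖ ∂P
          ≤ ∫ ω, (v z.1 ω * v z.1 ω + v z.2 ω * v z.2 ω) / 2 ∂P := by
            refine integral_mono_of_nonneg (.of_forall fun _ => norm_nonneg _)
              (((hmul _ _).add (hmul _ _)).div_const 2) (.of_forall fun ω => ?_)
            have h1 : |φ z.1| * |ψ z.2| ≤ 1 := mul_le_one₀ (hφ1 _) (abs_nonneg _) (hψ1 _)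
            have h2 := mul_le_mul_of_nonneg_left h1
              (mul_nonneg (abs_nonneg (v z.1 ω)) (abs_nonneg (v z.2 ω)))
            simp only [Real.norm_eq_abs, abs_mul]
            nlinarith [sq_nonneg (|v z.1 ω| - |v z.2 ω|), sq_abs (v z.1 ω), sq_abs (v z.2 ω)]
        _ = R 0 := by
            rw [integral_div, integral_add (hmul _ _) (hmul _ _), hsq, hsq]; ring
  have hE : ∀ z : ℝ × ℝ, ∫ ω, v z.1 ω * φ z.1 * (v z.2 ω * ψ z.2) ∂P =
      R (z.1 - z.2) * (φ z.1 * ψ z.2) := fun z => by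
    rw [← hcov, ← integral_mul_const]
    congr 1; ext ω; ring
  have hint' := hint.integral_prod_right
  simp only [hE] at hint'
  calc ∫ ω, (∫ u, v u ω * φ u ∂μ) * (∫ y, v y ω * ψ y ∂μ) ∂P
      = ∫ ω, ∫ z : ℝ × ℝ, v z.1 ω * φ z.1 * (v z.2 ω * ψ z.2) ∂(μ.prod μ) ∂P := by
        refine integral_congr_ae (.of_forall fun ω => ?_)
        exact (integral_prod_mul (fun u => v u ω * φ u) (fun u => v u ω * ψ u)).symm
    _ = ∫ z : ℝ × ℝ, ∫ ω, v z.1 ω * φ z.1 * (v z.2 ω * ψ z.2) ∂P ∂(μ.prod μ) :=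
        integral_integral_swap hint
    _ = ∫ u, ∫ y, R (u - y) * (φ u * ψ y) ∂μ ∂μ := by
        simp only [hE]
        exact integral_prod _ hint'

/-- An oscillating factor with bounded primitive tames a primitive of `g`. -/
theorem abs_integral_mul_primitive_le {g θ Θ : ℝ → ℝ} (hg : Continuous g) (hθ : Continuous θ)
    (hΘ : ∀ x, HasDerivAt Θ (θ x) x) (hΘ1 : ∀ x, |Θ x| ≤ 1) {a b : ℝ} (hab : a ≤ b) :
    |∫ u in a..b, θ u * ∫ z in (0 : ℝ)..(u - a), g z| ≤
      2 * ∫ z in (0 : ℝ)..(b - a), |g z| := by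
  have hG : ∀ u, HasDerivAt (fun u => ∫ z in (0 : ℝ)..(u - a), g z) (g (u - a)) u := fun u =>
    (hg.integral_hasStrictDerivAt 0 (u - a)).hasDerivAt.comp_sub_const u a
  have key := intervalIntegral.integral_deriv_mul_eq_sub_of_hasDeriv_right (a := a) (b := b)
    (u := Θ) (v := fun u => ∫ z in (0 : ℝ)..(u - a), g z) (u' := θ) (v' := fun u => g (u - a))
    (fun x _ => (hΘ x).continuousAt.continuousWithinAt)
    (fun x _ => (hG x).continuousAt.continuousWithinAt)
    (fun x _ => (hΘ x).hasDerivWithinAt) (fun x _ => (hG x).hasDerivWithinAt)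
    (hθ.intervalIntegrable _ _) ((hg.comp (continuous_sub_right a)).intervalIntegrable _ _)
  have hΘc : Continuous Θ := continuous_iff_continuousAt.2 fun x => (hΘ x).continuousAt
  have hGc : Continuous fun u => ∫ z in (0 : ℝ)..(u - a), g z :=
    continuous_iff_continuousAt.2 fun x => (hG x).continuousAt
  have hgc : Continuous fun u => g (u - a) := hg.comp (continuous_sub_right a)
  rw [intervalIntegral.integral_add
    (f := fun x => θ x * ∫ z in (0 : ℝ)..(x - a), g z) (g := fun x => Θ x * g (x - a))
    ((hθ.mul hGc).intervalIntegrable _ _) ((hΘc.mul hgc).intervalIntegrable _ _)] at key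
  simp only [sub_self, intervalIntegral.integral_same, mul_zero, sub_zero] at key
  have h1 : |Θ b * ∫ z in (0 : ℝ)..(b - a), g z| ≤ ∫ z in (0 : ℝ)..(b - a), |g z| := by
    rw [abs_mul]
    calc _ ≤ 1 * |∫ z in (0 : ℝ)..(b - a), g z| :=
          mul_le_mul_of_nonneg_right (hΘ1 b) (abs_nonneg _)
      _ ≤ _ := by
          rw [one_mul]
          exact intervalIntegral.abs_integral_le_integral_abs (sub_nonneg.2 hab)
  have h2 : |∫ u in a..b, Θ u * g (u - a)| ≤ ∫ z in (0 : ℝ)..(b - a), |g z| := by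
    calc _ ≤ ∫ u in a..b, |Θ u * g (u - a)| :=
          intervalIntegral.abs_integral_le_integral_abs hab
      _ ≤ ∫ u in a..b, |g (u - a)| := by
          refine intervalIntegral.integral_mono_on hab ((hΘc.mul hgc).abs.intervalIntegrable _ _)
            (hgc.abs.intervalIntegrable _ _) fun u _ => ?_
          rw [abs_mul]
          exact mul_le_of_le_one_left (abs_nonneg _) (hΘ1 u)
      _ = _ := by
          rw [intervalIntegral.integral_comp_sub_right (fun z => |g z|), sub_self]
  have h3 : (∫ u in a..b, θ u * ∫ z in (0 : ℝ)..(u - a), g z) =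
      Θ b * (∫ z in (0 : ℝ)..(b - a), g z) - ∫ u in a..b, Θ u * g (u - a) := by linarith
  rw [h3]
  exact (abs_sub _ _).trans (by linarith)

theorem abs_integral_mul_primitive_reflect_le {g θ Θ : ℝ → ℝ} (hg : Continuous g)
    (hθ : Continuous θ) (hΘ : ∀ x, HasDerivAt Θ (θ x) x) (hΘ1 : ∀ x, |Θ x| ≤ 1) {a b : ℝ}
    (hab : a ≤ b) :
    |∫ u in a..b, θ u * ∫ z in (0 : ℝ)..(b - u), g z| ≤
      2 * ∫ z in (0 : ℝ)..(b - a), |g z| := by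
  have h := abs_integral_mul_primitive_le hg (θ := fun u => θ (a + b - u))
    (Θ := fun u => -Θ (a + b - u)) (hθ.comp (continuous_sub_left _))
    (fun x => by simpa using ((hΘ (a + b - x)).comp_const_sub (a + b) x).fun_neg)
    (fun x => by simpa using hΘ1 _) hab
  have e := intervalIntegral.integral_comp_sub_left (a := a) (b := b)
    (fun u => θ u * ∫ z in (0 : ℝ)..(b - u), g z) (a + b)
  simp only [add_sub_cancel_right, add_sub_cancel_left] at e
  rw [← e]
  have hsub : ∀ x, b - (a + b - x) = x - a := fun x => by ring
  simpa only [hsub] using h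

theorem oscillatory_double_integral_le {R : ℝ → ℝ} (hR : Continuous R)
    (heven : ∀ t, R (-t) = R t) (p q : ℝ) {a b : ℝ} (hab : a ≤ b) :
    |(∫ u in a..b, ∫ y in a..b, R (u - y) * (Real.sin (u + p) * Real.sin (y + q))) -
      Real.cos (p - q) * ∫ x in (0 : ℝ)..(b - a), ∫ z in (0 : ℝ)..x, R z * Real.cos z| ≤
      4 * ∫ z in (0 : ℝ)..(b - a), |R z| := by
  set C : ℝ → ℝ := fun x => ∫ z in (0 : ℝ)..x, R z * Real.cos z with hC
  set S : ℝ → ℝ := fun x => ∫ z in (0 : ℝ)..x, R z * Real.sin z with hS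
  have hRc : Continuous fun z => R z * Real.cos z := hR.mul Real.continuous_cos
  have hRs : Continuous fun z => R z * Real.sin z := hR.mul Real.continuous_sin
  have hCc : Continuous C := intervalIntegral.continuous_primitive
    (fun _ _ => hRc.intervalIntegrable _ _) 0
  have hSc : Continuous S := intervalIntegral.continuous_primitive
    (fun _ _ => hRs.intervalIntegrable _ _) 0
  have hCodd : ∀ x, C (-x) = -C x := fun x => by
    have := intervalIntegral.integral_comp_neg (a := 0) (b := x) fun z => R z * Real.cos z
    simp only [heven, Real.cos_neg, neg_zero] at this
    simp only [hC]
    rw [this, intervalIntegral.integral_symm]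
  have hSeven : ∀ x, S (-x) = S x := fun x => by
    have := intervalIntegral.integral_comp_neg (a := 0) (b := x) fun z => R z * Real.sin z
    simp only [heven, Real.sin_neg, neg_zero, mul_neg, intervalIntegral.integral_neg] at this
    simp only [hS]
    rw [intervalIntegral.integral_symm, ← this, neg_neg]
  have hinner : ∀ u, ∫ y in a..b, R (u - y) * (Real.sin (u + p) * Real.sin (y + q)) =
      Real.sin (u + p) * (Real.sin (u + q) * (C (u - a) + C (b - u)) -
        Real.cos (u + q) * (S (u - a) - S (b - u))) := fun u => by
    have h1 : ∀ y, R (u - y) * (Real.sin (u + p) * Real.sin (y + q)) =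
        (fun z => Real.sin (u + p) * (Real.sin (u + q) * (R z * Real.cos z) -
          Real.cos (u + q) * (R z * Real.sin z))) (u - y) := fun y => by
      have : y + q = (u + q) - (u - y) := by ring
      simp only
      rw [this, Real.sin_sub (u + q)]
      ring
    rw [intervalIntegral.integral_congr fun y _ => h1 y,
      intervalIntegral.integral_comp_sub_left (fun z => Real.sin (u + p) *
        (Real.sin (u + q) * (R z * Real.cos z) - Real.cos (u + q) * (R z * Real.sin z))),
      intervalIntegral.integral_const_mul,
      intervalIntegral.integral_sub ((hRc.const_mul _).intervalIntegrable _ _)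
      ((hRs.const_mul _).intervalIntegrable _ _), intervalIntegral.integral_const_mul,
      intervalIntegral.integral_const_mul,
      ← intervalIntegral.integral_interval_sub_left (a := 0) (hRc.intervalIntegrable _ _)
        (hRc.intervalIntegrable _ _),
      ← intervalIntegral.integral_interval_sub_left (a := 0) (hRs.intervalIntegrable _ _)
        (hRs.intervalIntegrable _ _)]
    change Real.sin (u + p) * (Real.sin (u + q) * (C (u - a) - C (u - b)) -
      Real.cos (u + q) * (S (u - a) - S (u - b))) = _
    rw [← neg_sub b u, hCodd, hSeven, sub_neg_eq_add]
  have hCa : Continuous fun u => C (u - a) := hCc.comp (continuous_sub_right a)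
  have hCb : Continuous fun u => C (b - u) := hCc.comp (continuous_sub_left b)
  have hSa : Continuous fun u => S (u - a) := hSc.comp (continuous_sub_right a)
  have hSb : Continuous fun u => S (b - u) := hSc.comp (continuous_sub_left b)
  set k : ℝ → ℝ := fun u => Real.cos (2 * u + (p + q)) with hk
  set l : ℝ → ℝ := fun u => Real.sin (2 * u + (p + q)) with hl
  have hkc : Continuous k := by fun_prop
  have hlc : Continuous l := by fun_prop
  have hlin : ∀ x, HasDerivAt (fun u : ℝ => 2 * u + (p + q)) 2 x := fun x => by
    simpa using ((hasDerivAt_id x).const_mul 2).add_const (p + q)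
  have hkd : ∀ x, HasDerivAt (fun u => l u / 2) (k x) x := fun x => by
    have := ((Real.hasDerivAt_sin _).comp x (hlin x)).div_const 2
    simpa [hk, hl, Function.comp_def] using this
  have hld : ∀ x, HasDerivAt (fun u => -k u / 2) (l x) x := fun x => by
    have := (((Real.hasDerivAt_cos _).comp x (hlin x)).neg).div_const 2
    simpa [hk, hl, Function.comp_def] using this
  have hl1 : ∀ x, |l x / 2| ≤ 1 := fun x => by
    have := abs_le.1 (Real.abs_sin_le_one (2 * x + (p + q)))
    exact abs_le.2 ⟨by simp only [hl]; linarith [this.1], by simp only [hl]; linarith [this.2]⟩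
  have hk1 : ∀ x, |-k x / 2| ≤ 1 := fun x => by
    have := abs_le.1 (Real.abs_cos_le_one (2 * x + (p + q)))
    exact abs_le.2 ⟨by simp only [hk]; linarith [this.2], by simp only [hk]; linarith [this.1]⟩
  have hsplit : ∀ u, Real.sin (u + p) * (Real.sin (u + q) * (C (u - a) + C (b - u)) -
        Real.cos (u + q) * (S (u - a) - S (b - u))) =
      Real.cos (p - q) / 2 * (C (u - a) + C (b - u)) -
        Real.sin (p - q) / 2 * (S (u - a) - S (b - u)) -
        1 / 2 * (k u * C (u - a) + k u * C (b - u)) -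
        1 / 2 * (l u * S (u - a) - l u * S (b - u)) := fun u => by
    have e1 : p - q = (u + p) - (u + q) := by ring
    have e2 : 2 * u + (p + q) = (u + p) + (u + q) := by ring
    simp only [hk, hl]
    rw [e1, e2, Real.cos_sub, Real.sin_sub, Real.cos_add (u + p), Real.sin_add (u + p)]
    ring
  have hval : (∫ u in a..b, ∫ y in a..b, R (u - y) * (Real.sin (u + p) * Real.sin (y + q))) =
      Real.cos (p - q) * (∫ x in (0 : ℝ)..(b - a), C x) -
        1 / 2 * ((∫ u in a..b, k u * C (u - a)) + ∫ u in a..b, k u * C (b - u)) -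
        1 / 2 * ((∫ u in a..b, l u * S (u - a)) - ∫ u in a..b, l u * S (b - u)) := by
    simp only [hinner, hsplit]
    have I : ∀ f : ℝ → ℝ, Continuous f → IntervalIntegrable f volume a b :=
      fun f hf => hf.intervalIntegrable _ _
    rw [intervalIntegral.integral_sub (I _ (by fun_prop)) (I _ (by fun_prop)),
      intervalIntegral.integral_sub (I _ (by fun_prop)) (I _ (by fun_prop)),
      intervalIntegral.integral_sub (I _ (by fun_prop)) (I _ (by fun_prop))]
    simp only [intervalIntegral.integral_const_mul]
    rw [intervalIntegral.integral_add (I _ (by fun_prop)) (I _ (by fun_prop)),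
      intervalIntegral.integral_sub (I _ (by fun_prop)) (I _ (by fun_prop)),
      intervalIntegral.integral_add (I _ (by fun_prop)) (I _ (by fun_prop)),
      intervalIntegral.integral_sub (I _ (by fun_prop)) (I _ (by fun_prop)),
      intervalIntegral.integral_comp_sub_right C, intervalIntegral.integral_comp_sub_left C,
      intervalIntegral.integral_comp_sub_right S, intervalIntegral.integral_comp_sub_left S]
    simp only [sub_self]
    ring
  have hF : ∀ f : ℝ → ℝ, Continuous f → (∀ x, |f x| ≤ 1) →
      ∫ z in (0 : ℝ)..(b - a), |R z * f z| ≤ ∫ z in (0 : ℝ)..(b - a), |R z| := fun f hf h1 => by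
    refine intervalIntegral.integral_mono_on (sub_nonneg.2 hab)
      ((hR.mul hf).abs.intervalIntegrable _ _) (hR.abs.intervalIntegrable _ _) fun u _ => ?_
    rw [abs_mul]
    exact mul_le_of_le_one_right (abs_nonneg _) (h1 u)
  have hFc := hF _ Real.continuous_cos Real.abs_cos_le_one
  have hFs := hF _ Real.continuous_sin Real.abs_sin_le_one
  have b1 := abs_le.1 (abs_integral_mul_primitive_le hRc hkc hkd hl1 hab)
  have b2 := abs_le.1 (abs_integral_mul_primitive_reflect_le hRc hkc hkd hl1 hab)
  have b3 := abs_le.1 (abs_integral_mul_primitive_le hRs hlc hld hk1 hab)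
  have b4 := abs_le.1 (abs_integral_mul_primitive_reflect_le hRs hlc hld hk1 hab)
  rw [hval]
  exact abs_le.2 ⟨by linarith [b1.1, b1.2, b2.1, b2.2, b3.1, b3.2, b4.1, b4.2],
    by linarith [b1.1, b1.2, b2.1, b2.2, b3.1, b3.2, b4.1, b4.2]⟩

theorem tendsto_average_of_tendsto {f : ℝ → ℝ} (hf : Continuous f) {l : ℝ}
    (h : Tendsto f atTop (𝓝 l)) :
    Tendsto (fun T => T⁻¹ * ∫ x in (0 : ℝ)..T, f x) atTop (𝓝 l) := by
  rw [Metric.tendsto_atTop] at h ⊢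
  intro ε hε
  obtain ⟨N, hN⟩ := h (ε / 2) (half_pos hε)
  set N' := max N 1
  have hint : ∀ x y, IntervalIntegrable (fun x => f x - l) volume x y := fun x y =>
    (hf.sub continuous_const).intervalIntegrable _ _
  set K := |∫ x in (0 : ℝ)..N', (f x - l)|
  refine ⟨max N' (2 * K / ε + 1), fun T hT => ?_⟩
  have hT1 : N' ≤ T := (le_max_left _ _).trans hT
  have hT2 : 2 * K / ε + 1 ≤ T := (le_max_right _ _).trans hT
  have hT0 : 0 < T := lt_of_lt_of_le one_pos ((le_max_right N 1).trans hT1)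
  have hKT : K < T * (ε / 2) := by
    have : 2 * K / ε < T := by linarith
    rw [div_lt_iff₀ hε] at this
    linarith
  have htail : |∫ x in N'..T, (f x - l)| ≤ ε / 2 * (T - N') := by
    have := intervalIntegral.norm_integral_le_of_norm_le_const (a := N') (b := T)
      (f := fun x => f x - l) (C := ε / 2) fun x hx => by
        rw [Set.uIoc_of_le hT1] at hx
        exact (hN x ((le_max_left N 1).trans hx.1.le)).le
    rwa [abs_of_nonneg (sub_nonneg.2 hT1), Real.norm_eq_abs] at this
  have hN'0 : 0 ≤ N' := zero_le_one.trans (le_max_right N 1)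
  have htot : |∫ x in (0 : ℝ)..T, (f x - l)| < T * ε := by
    rw [← intervalIntegral.integral_add_adjacent_intervals (hint 0 N') (hint N' T)]
    refine (abs_add_le _ _).trans_lt ?_
    nlinarith
  have heq : T⁻¹ * (∫ x in (0 : ℝ)..T, f x) - l = T⁻¹ * ∫ x in (0 : ℝ)..T, (f x - l) := by
    rw [intervalIntegral.integral_sub (hf.intervalIntegrable _ _) (by simp),
      intervalIntegral.integral_const]
    simp only [sub_zero, smul_eq_mul]
    field_simp
  rw [Real.dist_eq, heq, abs_mul, abs_of_pos (inv_pos.2 hT0), inv_mul_lt_iff₀ hT0]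
  exact htot

/-- A bounded function which contracts by a fixed factor under doubling of the argument has
averages tending to zero. -/
theorem tendsto_average_zero_of_doubling {f : ℝ → ℝ} (hf : Continuous f) {M c : ℝ}
    (hM : ∀ t, |f t| ≤ M) (hc0 : 0 ≤ c) (hc1 : c < 1)
    (hdouble : ∀ᶠ t in atTop, |f (2 * t)| ≤ c * |f t|) :
    Tendsto (fun T => T⁻¹ * ∫ x in (0 : ℝ)..T, |f x|) atTop (𝓝 0) := by
  set A : ℝ → ℝ := fun T => T⁻¹ * ∫ x in (0 : ℝ)..T, |f x|
  have hint : ∀ x y, IntervalIntegrable (fun x => |f x|) volume x y := fun x y =>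
    hf.abs.intervalIntegrable _ _
  have hM0 : 0 ≤ M := (abs_nonneg _).trans (hM 0)
  have hA0 : ∀ T > 0, 0 ≤ A T := fun T hT =>
    mul_nonneg (inv_pos.2 hT).le (intervalIntegral.integral_nonneg hT.le fun _ _ => abs_nonneg _)
  have hAM : ∀ T > 0, A T ≤ M := fun T hT => by
    rw [show A T = T⁻¹ * ∫ x in (0 : ℝ)..T, |f x| from rfl, inv_mul_le_iff₀ hT]
    calc _ ≤ ∫ x in (0 : ℝ)..T, M :=
          intervalIntegral.integral_mono_on hT.le (hint _ _) (by simp) fun x _ => hM x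
      _ = T * M := by simp
  obtain ⟨N, hN⟩ := eventually_atTop.1 hdouble
  set N' := max N 1
  have hN'1 : 1 ≤ N' := le_max_right N 1
  have hstep : ∀ T, N' ≤ T → A (2 * T) ≤ N' * M / T + c * A T := fun T hT => by
    have hT0 : 0 < T := by linarith
    have hdb : ∀ x y, IntervalIntegrable (fun x => |f (2 * x)|) volume x y := fun x y =>
      (hf.comp (continuous_const_mul 2)).abs.intervalIntegrable _ _
    have h1 : A (2 * T) = T⁻¹ * ∫ x in (0 : ℝ)..T, |f (2 * x)| := by
      rw [intervalIntegral.integral_comp_mul_left (fun x => |f x|) two_ne_zero]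
      simp only [A, mul_zero, smul_eq_mul, mul_inv]
      ring
    have h2 : ∫ x in (0 : ℝ)..N', |f (2 * x)| ≤ N' * M := by
      calc _ ≤ ∫ x in (0 : ℝ)..N', M :=
            intervalIntegral.integral_mono_on (by linarith) (hdb _ _) (by simp) fun x _ => hM _
        _ = N' * M := by simp
    have h3 : ∫ x in N'..T, |f (2 * x)| ≤ c * ∫ x in (0 : ℝ)..T, |f x| := by
      calc _ ≤ ∫ x in N'..T, c * |f x| :=
            intervalIntegral.integral_mono_on hT (hdb _ _) ((hint _ _).const_mul _)
              fun x hx => hN x ((le_max_left N 1).trans hx.1)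
        _ = c * ∫ x in N'..T, |f x| := intervalIntegral.integral_const_mul _ _
        _ ≤ _ := by
            refine mul_le_mul_of_nonneg_left ?_ hc0
            rw [← intervalIntegral.integral_add_adjacent_intervals (hint 0 N') (hint N' T)]
            exact le_add_of_nonneg_left
              (intervalIntegral.integral_nonneg (by linarith) fun _ _ => abs_nonneg _)
    rw [h1, ← intervalIntegral.integral_add_adjacent_intervals (hdb 0 N') (hdb N' T)]
    calc _ ≤ T⁻¹ * (N' * M + c * ∫ x in (0 : ℝ)..T, |f x|) :=
          mul_le_mul_of_nonneg_left (add_le_add h2 h3) (inv_pos.2 hT0).le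
      _ = _ := by simp only [A]; ring
  obtain ⟨d, hcd, hd1⟩ := exists_between hc1
  have hd0 : 0 < d := hc0.trans_lt hcd
  have hiter : ∀ n : ℕ, ∀ᶠ T in atTop, A T ≤ d ^ n * (M + 1) := fun n => by
    induction n with
    | zero =>
      filter_upwards [eventually_gt_atTop 0] with T hT
      linarith [hAM T hT]
    | succ n ih =>
      have hpos : 0 < (d - c) * (d ^ n * (M + 1)) := by
        have := sub_pos.2 hcd
        positivity
      have hsmall : ∀ᶠ T : ℝ in atTop, N' * M / T < (d - c) * (d ^ n * (M + 1)) :=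
        (tendsto_id.const_div_atTop (N' * M)).eventually_lt_const hpos
      have h2 : ∀ᶠ T in atTop, A (2 * T) ≤ d ^ (n + 1) * (M + 1) := by
        filter_upwards [ih, hsmall, eventually_ge_atTop N'] with T h1 h2 h3
        calc A (2 * T) ≤ N' * M / T + c * A T := hstep T h3
          _ ≤ (d - c) * (d ^ n * (M + 1)) + c * (d ^ n * (M + 1)) :=
              add_le_add h2.le (mul_le_mul_of_nonneg_left h1 hc0)
          _ = _ := by ring
      have h3 := (tendsto_id.atTop_div_const (r := (2 : ℝ)) two_pos).eventually h2
      filter_upwards [h3] with T hT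
      rwa [id, mul_div_cancel₀ T two_ne_zero] at hT
  refine tendsto_order.2 ⟨fun a ha => ?_, fun a ha => ?_⟩
  · filter_upwards [eventually_gt_atTop 0] with T hT using ha.trans_le (hA0 T hT)
  · have hlim : Tendsto (fun n : ℕ => d ^ n * (M + 1)) atTop (𝓝 0) := by
      simpa using (tendsto_pow_atTop_nhds_zero_of_lt_one hd0.le hd1).mul_const (M + 1)
    obtain ⟨n, hn⟩ := (hlim.eventually_lt_const ha).exists
    filter_upwards [hiter n] with T hT using hT.trans_lt hn

theorem eventually_abs_two_mul_le_of_slowlyVarying {γ : ℝ} (hγ : 0 < γ) {L R : ℝ → ℝ}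
    (hLpos : ∀ t > 0, 0 < L t) (hLslow : Tendsto (fun t => L (2 * t) / L t) atTop (𝓝 1))
    (hRL : ∀ t > 0, R t = L t / t ^ γ) :
    ∃ c, 0 ≤ c ∧ c < 1 ∧ ∀ᶠ t in atTop, |R (2 * t)| ≤ c * |R t| := by
  have h2γ : (1 : ℝ) < 2 ^ γ := Real.one_lt_rpow one_lt_two hγ
  obtain ⟨k, hk1, hk2⟩ := exists_between h2γ
  refine ⟨k / 2 ^ γ, by positivity, (div_lt_one (by positivity)).2 hk2, ?_⟩
  filter_upwards [hLslow.eventually_lt_const hk1, eventually_gt_atTop 0] with t ht ht0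
  have h2t : 0 < 2 * t := by positivity
  have hL := hLpos t ht0
  rw [div_lt_iff₀ hL] at ht
  rw [hRL _ h2t, hRL _ ht0, abs_of_pos (div_pos (hLpos _ h2t) (by positivity)),
    abs_of_pos (div_pos hL (by positivity)), Real.mul_rpow zero_le_two ht0.le, div_mul_div_comm]
  gcongr

theorem tendsto_scaled_double_integral {R : ℝ → ℝ} (hR : Continuous R)
    (heven : ∀ t, R (-t) = R t)
    (hav : Tendsto (fun T => T⁻¹ * ∫ x in (0 : ℝ)..T, |R x|) atTop (𝓝 0)) {D : ℝ}
    (hD : Tendsto (fun x => ∫ z in (0 : ℝ)..x, R z * Real.cos z) atTop (𝓝 D)) (p q : ℝ)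
    {s t : ℝ} (hst : s ≤ t) :
    Tendsto (fun ε : ℝ => ε ^ 2 * ∫ u in (s / ε ^ 2)..(t / ε ^ 2),
        ∫ y in (s / ε ^ 2)..(t / ε ^ 2), R (u - y) * (Real.sin (u + p) * Real.sin (y + q)))
      (𝓝[>] 0) (𝓝 (Real.cos (p - q) * (D * (t - s)))) := by
  rcases hst.eq_or_lt with rfl | hlt
  · simp
  have hd : 0 < t - s := sub_pos.2 hlt
  have hT : Tendsto (fun ε : ℝ => (t - s) / ε ^ 2) (𝓝[>] 0) atTop := by
    have h1 : Tendsto (fun ε : ℝ => (ε⁻¹) ^ 2) (𝓝[>] 0) atTop :=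
      (tendsto_pow_atTop two_ne_zero).comp tendsto_inv_nhdsGT_zero
    simpa only [div_eq_mul_inv, inv_pow] using h1.const_mul_atTop hd
  have hC : Continuous fun x => ∫ z in (0 : ℝ)..x, R z * Real.cos z :=
    intervalIntegral.continuous_primitive
      (fun _ _ => (hR.mul Real.continuous_cos).intervalIntegrable _ _) 0
  have hmain := (((tendsto_average_of_tendsto hC hD).comp hT).const_mul (t - s)).const_mul
    (Real.cos (p - q))
  have herr := ((hav.comp hT).const_mul (t - s)).const_mul 4
  rw [mul_zero, mul_zero] at herr
  rw [mul_comm D]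
  refine tendsto_of_tendsto_of_dist hmain (squeeze_zero' (.of_forall fun _ => dist_nonneg) ?_ herr)
  filter_upwards [self_mem_nhdsWithin] with ε (hε : 0 < ε)
  have hε2 : 0 < ε ^ 2 := by positivity
  have hb := oscillatory_double_integral_le hR heven p q
    (div_le_div_of_nonneg_right hst hε2.le)
  rw [← sub_div] at hb
  have hscale : ∀ I : ℝ, (t - s) * (((t - s) / ε ^ 2)⁻¹ * I) = ε ^ 2 * I := fun I => by
    have := hd.ne'
    field_simp
  rw [dist_comm, Real.dist_eq]
  simp only [Function.comp_apply, hscale]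
  rw [mul_left_comm, ← mul_sub, abs_mul, abs_of_pos hε2, mul_left_comm 4]
  exact mul_le_mul_of_nonneg_left hb hε2.le

theorem oscillatory_increment_eq {f φ : ℝ → ℝ} (hf : Continuous f) (hφ : Continuous φ)
    {ε : ℝ} (hε : 0 < ε) (s t : ℝ) :
    (ε⁻¹ * ∫ τ in (0 : ℝ)..t, f (τ / ε ^ 2) * φ (τ / ε ^ 2)) -
      (ε⁻¹ * ∫ τ in (0 : ℝ)..s, f (τ / ε ^ 2) * φ (τ / ε ^ 2)) =
      ε * ∫ u in (s / ε ^ 2)..(t / ε ^ 2), f u * φ u := by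
  have hi : ∀ x y, IntervalIntegrable (fun τ => f (τ / ε ^ 2) * φ (τ / ε ^ 2)) volume x y :=
    fun x y => Continuous.intervalIntegrable (by fun_prop) _ _
  rw [← mul_sub, intervalIntegral.integral_interval_sub_left (hi _ _) (hi _ _),
    intervalIntegral.integral_comp_div (fun u => f u * φ u) (by positivity), smul_eq_mul]
  field_simp



/-- With `v` a centered stationary Gaussian process with covariance
`R(t) = L(t)/t^γ` (`L` slowly varying, `γ ∈ (0,2)`, slow-increase condition when `γ ≤ 1`),
`wᵢ^ε` the oscillatory integrals of the rescaled noise, and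
`D₁₁ = lim_{x→∞} ∫_0^x R(z)cos(z) dz`, for all `s, t ≥ 0` and `i ∈ {1,2}`:
`E[(wᵢ^ε(t)−wᵢ^ε(s))²] → D₁₁|t−s|` and
`E[(w₁^ε(t)−w₁^ε(s))(w₂^ε(t)−w₂^ε(s))] → 0` as `ε → 0⁺`. -/
theorem stmt_3
    {Ω : Type*} [MeasurableSpace Ω] (P : Measure Ω) [IsProbabilityMeasure P]
    (γ : ℝ) (hγ : γ ∈ Set.Ioo (0:ℝ) 2)
    (L : ℝ → ℝ) (hLpos : ∀ t > 0, 0 < L t)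
    (hLslow : ∀ s > 0, Tendsto (fun t => L (s * t) / L t) atTop (𝓝 1))
    (R : ℝ → ℝ) (hReven : ∀ t, R (-t) = R t)
    (hRbdd : ∃ M, ∀ t, |R t| ≤ M) (hRcont : Continuous R)
    (hRL : ∀ t > 0, R t = L t / t ^ γ)
    (hLslowinc : γ ≤ 1 → ∃ L' : ℝ → ℝ, (∀ t > 0, HasDerivAt L (L' t) t) ∧
      Tendsto (fun t => t * L' t / L t) atTop (𝓝 0))
    (v : ℝ → Ω → ℝ)
    (hvmeas : Measurable (Function.uncurry v))
    (hvcont : ∀ ω, Continuous fun t => v t ω)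
    (hvcentered : ∀ t, ∫ ω, v t ω ∂P = 0)
    (hvgauss : ∀ (n : ℕ) (c : Fin n → ℝ) (t : Fin n → ℝ),
      ∃ (m : ℝ) (σ2 : NNReal),
        P.map (fun ω => ∑ i, c i * v (t i) ω) = ProbabilityTheory.gaussianReal m σ2)
    (hvcov : ∀ s t : ℝ, ∫ ω, v t ω * v s ω ∂P = R (t - s))
    (w : Fin 2 → ℝ → ℝ → Ω → ℝ)
    (hw1 : ∀ ε t ω, w 0 ε t ω = ε⁻¹ * ∫ τ in (0:ℝ)..t, v (τ / ε ^ 2) ω * Real.sin (τ / ε ^ 2))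
    (hw2 : ∀ ε t ω, w 1 ε t ω = ε⁻¹ * ∫ τ in (0:ℝ)..t, v (τ / ε ^ 2) ω * Real.cos (τ / ε ^ 2))
    (D : ℝ) (hD : Tendsto (fun x => ∫ z in (0:ℝ)..x, R z * Real.cos z) atTop (𝓝 D)) :
    ∀ s t : ℝ, 0 ≤ s → 0 ≤ t →
      (∀ i : Fin 2,
        Tendsto (fun ε => ∫ ω, (w i ε t ω - w i ε s ω) ^ 2 ∂P)
          (𝓝[>] 0) (𝓝 (D * |t - s|))) ∧
      Tendsto (fun ε => ∫ ω, (w 0 ε t ω - w 0 ε s ω) * (w 1 ε t ω - w 1 ε s ω) ∂P)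
        (𝓝[>] 0) (𝓝 0) := by
  obtain ⟨M, hM⟩ := hRbdd
  have hL2 : ∀ t, MemLp (v t) 2 P := fun t => by
    obtain ⟨m, σ2, h⟩ := hvgauss 1 (fun _ => 1) (fun _ => t)
    refine memLp_two_of_map_eq_gaussianReal (hvmeas.comp measurable_prodMk_left) (m := m)
      (σ2 := σ2) ?_
    simpa using h
  obtain ⟨c, hc0, hc1, hc⟩ :=
    eventually_abs_two_mul_le_of_slowlyVarying hγ.1 hLpos (hLslow 2 two_pos) hRL
  have hav := tendsto_average_zero_of_doubling hRcont hM hc0 hc1 hc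
  set p : Fin 2 → ℝ := ![0, Real.pi / 2] with hp
  have hw : ∀ i ε t ω, w i ε t ω =
      ε⁻¹ * ∫ τ in (0 : ℝ)..t, v (τ / ε ^ 2) ω * Real.sin (τ / ε ^ 2 + p i) := fun i ε t ω => by
    fin_cases i
    · simpa [hp] using hw1 ε t ω
    · simpa [hp, Real.sin_add_pi_div_two] using hw2 ε t ω
  have hordered : ∀ i j s t, s ≤ t →
      Tendsto (fun ε => ∫ ω, (w i ε t ω - w i ε s ω) * (w j ε t ω - w j ε s ω) ∂P)
        (𝓝[>] 0) (𝓝 (Real.cos (p i - p j) * (D * (t - s)))) := fun i j s t hst => by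
    refine (tendsto_scaled_double_integral hRcont hReven hav hD (p i) (p j) hst).congr' ?_
    filter_upwards [self_mem_nhdsWithin] with ε (hε : 0 < ε)
    have hφ : ∀ i, Continuous fun x => Real.sin (x + p i) := fun i => by fun_prop
    rw [← integral_mul_intervalIntegral_eq hvmeas hL2 hvcov (hφ i) (hφ j)
      (fun _ => Real.abs_sin_le_one _) (fun _ => Real.abs_sin_le_one _)
      (div_le_div_of_nonneg_right hst (sq_nonneg ε)), ← integral_const_mul]
    congr 1
    ext ω
    rw [hw, hw, hw, hw, oscillatory_increment_eq (hvcont ω) (hφ i) hε,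
      oscillatory_increment_eq (hvcont ω) (hφ j) hε]
    ring
  have hall : ∀ i j s t,
      Tendsto (fun ε => ∫ ω, (w i ε t ω - w i ε s ω) * (w j ε t ω - w j ε s ω) ∂P)
        (𝓝[>] 0) (𝓝 (Real.cos (p i - p j) * (D * |t - s|))) := fun i j s t => by
    rcases le_total s t with h | h
    · rw [abs_of_nonneg (sub_nonneg.2 h)]
      exact hordered i j s t h
    · rw [abs_sub_comm, abs_of_nonneg (sub_nonneg.2 h)]
      refine (hordered i j t s h).congr fun ε => ?_
      congr 1
      ext ω
      ring
  intro s t _ _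
  refine ⟨fun i => ?_, ?_⟩
  · simpa [sq] using hall i i s t
  · simpa [hp] using hall 0 1 s t
end

section
/- Assume γ ∈ (0,1) and R(t) = L(t)/t^γ for all t > 0. Set 𝓗 = 1 − γ/2 ∈ (1/2, 1) and σ(ε)² = L(ε⁻²) ε^{2γ}. Then for every 0 ≤ s ≤ t: lim_{ε→0} (2/σ(ε)²) ∫_s^t ∫_s^{r₁} R((r₁−r₂)/ε²) dr₂ dr₁ = (t−s)^{2𝓗} / (𝓗(2𝓗−1)). (This quantity equals E[(u^ε(t) − u^ε(s))²] for the renormalized integrated noise u^ε(t) = σ(ε)⁻¹ ∫_0^t v(s'/ε²) ds' of a centered stationary Gaussian process v with covariance R, and (t−s)^{2𝓗}/(𝓗(2𝓗−1)) = σ_𝓗²(t−s)^{2𝓗} is the variance of increments of a fractional Brownian motion with Hurst index 𝓗.) -/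
open MeasureTheory Filter Topology

/-- An additive form of Potter's bound: if the increments of a continuous function over every fixed
step vanish at infinity, then the function grows at most linearly with arbitrarily small slope,
uniformly in the (large) starting point. -/
theorem exists_abs_add_sub_le_of_tendsto_zero {h : ℝ → ℝ} (hc : Continuous h)
    (hlim : ∀ u, Tendsto (fun x => h (x + u) - h x) atTop (𝓝 0)) {δ : ℝ} (hδ : 0 < δ) :
    ∃ A, ∀ x ≥ A, ∀ u ≥ 0, |h (x + u) - h x| ≤ 2 + δ * u := by
  let E : ℕ → Set ℝ := fun n => {u | ∀ x ≥ (n : ℝ), |h (x + u) - h x| ≤ 1}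
  have hEclosed : ∀ n, IsClosed (E n) := fun n => by
    have : E n = ⋂ x ∈ Set.Ici (n : ℝ), {u | |h (x + u) - h x| ≤ 1} := by
      ext u; simp [E]
    rw [this]
    exact isClosed_biInter fun x _ => isClosed_le (by fun_prop) continuous_const
  have hEunion : ⋃ n, E n = Set.univ := by
    refine Set.eq_univ_of_forall fun u => Set.mem_iUnion.2 ?_
    have h1 : ∀ᶠ x in atTop, |h (x + u) - h x| ≤ 1 := by
      filter_upwards [Metric.tendsto_nhds.1 (hlim u) 1 one_pos] with x hx
      simpa [Real.dist_eq] using hx.le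
    obtain ⟨a, ha⟩ := eventually_atTop.1 h1
    obtain ⟨n, hn⟩ := exists_nat_ge a
    exact ⟨n, fun x hx => ha x (hn.trans hx)⟩
  obtain ⟨n, a, ha⟩ := nonempty_interior_of_iUnion_of_closed hEclosed hEunion
  obtain ⟨η, hη, hball⟩ := Metric.isOpen_iff.1 isOpen_interior a ha
  have hE : ∀ v, 0 ≤ v → v < η → a + v ∈ E n := fun v hv0 hv =>
    interior_subset (hball (by simpa [Real.dist_eq, abs_of_nonneg hv0] using hv))
  have hlocal : ∀ x ≥ n + a, ∀ v, 0 ≤ v → v < η → |h (x + v) - h x| ≤ 2 := by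
    intro x hx v hv0 hv
    have h1 := hE v hv0 hv (x - a) (by linarith)
    have h2 := hE 0 le_rfl hη (x - a) (by linarith)
    rw [show x - a + (a + v) = x + v by ring] at h1
    rw [show x - a + (a + 0) = x by ring] at h2
    rw [abs_le] at *
    constructor <;> linarith
  have hη' : 0 < η / 2 := by positivity
  have hstep : ∀ᶠ x in atTop, |h (x + η / 2) - h x| ≤ δ * (η / 2) := by
    filter_upwards [Metric.tendsto_nhds.1 (hlim (η / 2)) (δ * (η / 2)) (by positivity)] with x hx
    simpa [Real.dist_eq] using hx.le
  obtain ⟨B, hB⟩ := eventually_atTop.1 hstep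
  have hiter : ∀ k : ℕ, ∀ x ≥ B, |h (x + k * (η / 2)) - h x| ≤ k * (δ * (η / 2)) := by
    intro k
    induction k with
    | zero => intro x _; simp
    | succ k ih =>
      intro x hx
      have h1 := ih x hx
      have h2 := hB (x + k * (η / 2)) (by nlinarith [k.cast_nonneg (α := ℝ)])
      push_cast
      rw [show x + (k + 1) * (η / 2) = x + k * (η / 2) + η / 2 by ring]
      rw [abs_le] at *
      constructor <;> linarith
  refine ⟨max (n + a) B, fun x hx u hu => ?_⟩
  obtain ⟨hx1, hx2⟩ := max_le_iff.1 hx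
  set k := ⌊u / (η / 2)⌋₊
  have hk1 : k * (η / 2) ≤ u := by
    rw [← le_div_iff₀ hη']; exact Nat.floor_le (by positivity)
  have hk2 : u < (k + 1) * (η / 2) := by
    rw [← div_lt_iff₀ hη']; exact Nat.lt_floor_add_one _
  have hk0 : 0 ≤ (k : ℝ) * (η / 2) := by positivity
  have h1 := hiter k x hx2
  have h2 := hlocal (x + k * (η / 2)) (by linarith) (u - k * (η / 2)) (by linarith) (by linarith)
  rw [show x + k * (η / 2) + (u - k * (η / 2)) = x + u by ring] at h2
  have h3 : k * (δ * (η / 2)) ≤ δ * u := by nlinarith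
  rw [abs_le] at *
  constructor <;> linarith

/-- **Potter's bound** for a continuous slowly varying function. -/
theorem exists_potter_bound {L : ℝ → ℝ} (hLpos : ∀ t > 0, 0 < L t)
    (hLslow : ∀ s > 0, Tendsto (fun t => L (s * t) / L t) atTop (𝓝 1))
    (hLcont : ContinuousOn L (Set.Ioi 0)) {δ : ℝ} (hδ : 0 < δ) :
    ∃ A > 0, ∀ x y, A ≤ x → x ≤ y →
      L x ≤ Real.exp 2 * (y / x) ^ δ * L y ∧ L y ≤ Real.exp 2 * (y / x) ^ δ * L x := by
  have hc : Continuous fun x => Real.log (L (Real.exp x)) :=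
    (hLcont.comp_continuous Real.continuous_exp fun x => Real.exp_pos x).log
      fun x => (hLpos _ (Real.exp_pos x)).ne'
  have hlim : ∀ u, Tendsto
      (fun x => Real.log (L (Real.exp (x + u))) - Real.log (L (Real.exp x))) atTop (𝓝 0) := by
    intro u
    have h1 := ((hLslow _ (Real.exp_pos u)).comp Real.tendsto_exp_atTop).log one_ne_zero
    rw [Real.log_one] at h1
    refine h1.congr fun x => ?_
    have hu := hLpos _ (mul_pos (Real.exp_pos u) (Real.exp_pos x))
    simp only [Function.comp_apply]
    rw [Real.log_div hu.ne' (hLpos _ (Real.exp_pos x)).ne', add_comm x u, Real.exp_add]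
  obtain ⟨A, hA⟩ := exists_abs_add_sub_le_of_tendsto_zero hc hlim hδ
  refine ⟨Real.exp A, Real.exp_pos A, fun x y hx hxy => ?_⟩
  have hx0 : 0 < x := (Real.exp_pos A).trans_le hx
  have hy0 : 0 < y := hx0.trans_le hxy
  have hlog : 0 ≤ Real.log y - Real.log x := sub_nonneg.2 (Real.log_le_log hx0 hxy)
  have h1 := hA (Real.log x) ((Real.le_log_iff_exp_le hx0).2 hx) _ hlog
  simp only [add_sub_cancel, Real.exp_log hx0, Real.exp_log hy0] at h1
  have hLx := hLpos x hx0
  have hLy := hLpos y hy0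
  have hpow : Real.exp 2 * (y / x) ^ δ = Real.exp (2 + δ * (Real.log y - Real.log x)) := by
    rw [Real.rpow_def_of_pos (div_pos hy0 hx0), Real.log_div hy0.ne' hx0.ne', ← Real.exp_add,
      mul_comm δ]
  obtain ⟨h2, h3⟩ := abs_le.1 h1
  rw [hpow]
  constructor
  · rw [← Real.log_le_log_iff hLx (by positivity), Real.log_mul (Real.exp_pos _).ne' hLy.ne',
      Real.log_exp]
    linarith
  · rw [← Real.log_le_log_iff hLy (by positivity), Real.log_mul (Real.exp_pos _).ne' hLx.ne',
      Real.log_exp]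
    linarith

/-- The rescaled functions `x ↦ R (T x) T^γ / L T` are dominated, uniformly in large `T`, by a
function which is integrable near zero when `γ + δ < 1`. -/
theorem exists_abs_rescaled_le {γ δ : ℝ} (hγ : 0 < γ) (hδ : 0 < δ) {L R : ℝ → ℝ}
    (hLpos : ∀ t > 0, 0 < L t)
    (hLslow : ∀ s > 0, Tendsto (fun t => L (s * t) / L t) atTop (𝓝 1))
    (hLcont : ContinuousOn L (Set.Ioi 0))
    (hRbdd : ∃ M, ∀ t ≥ 0, |R t| ≤ M) (hRL : ∀ t > 0, R t = L t / t ^ γ) :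
    ∃ C, ∃ A > 0, ∀ T ≥ A, ∀ x > 0,
      |T ^ γ / L T * R (T * x)| ≤ C * (x ^ (-(γ + δ)) + x ^ (δ - γ)) := by
  obtain ⟨A, hA, hpot⟩ := exists_potter_bound hLpos hLslow hLcont hδ
  obtain ⟨M, hM⟩ := hRbdd
  have hM0 : 0 ≤ M := (abs_nonneg _).trans (hM 0 le_rfl)
  have hLA := hLpos A hA
  set D := M * (Real.exp 2 * A ^ γ / L A) with hD
  have hD0 : 0 ≤ D := by positivity
  refine ⟨Real.exp 2 + D, A, hA, fun T hT x hx => ?_⟩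
  have hT0 : 0 < T := hA.trans_le hT
  have hLT := hLpos T hT0
  have hp1 : 0 < x ^ (-(γ + δ)) := Real.rpow_pos_of_pos hx _
  have hp2 : 0 < x ^ (δ - γ) := Real.rpow_pos_of_pos hx _
  have he := Real.exp_pos 2
  have hTx : 0 < T * x := mul_pos hT0 hx
  rcases le_or_gt A (T * x) with hAx | hAx
  · have hLTx := hLpos _ hTx
    have hxg := Real.rpow_pos_of_pos hx γ
    have heq : T ^ γ / L T * R (T * x) = L (T * x) / L T * x ^ (-γ) := by
      rw [hRL _ hTx, Real.mul_rpow hT0.le hx.le, Real.rpow_neg hx.le]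
      have := Real.rpow_pos_of_pos hT0 γ
      field_simp
    rw [heq, abs_of_nonneg (by positivity)]
    have hpg := Real.rpow_pos_of_pos hx (-γ)
    rcases le_total x 1 with hx1 | hx1
    · have h1 := (hpot (T * x) T hAx (by nlinarith)).1
      have h2 : T / (T * x) = x⁻¹ := by field_simp
      rw [h2, Real.inv_rpow hx.le, ← Real.rpow_neg hx.le] at h1
      calc L (T * x) / L T * x ^ (-γ) ≤ Real.exp 2 * x ^ (-δ) * x ^ (-γ) := by
            gcongr; rwa [div_le_iff₀ hLT]
        _ = Real.exp 2 * x ^ (-(γ + δ)) := by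
            rw [mul_assoc, ← Real.rpow_add hx]; ring_nf
        _ ≤ _ := by nlinarith [mul_nonneg hD0 hp1.le, mul_nonneg hD0 hp2.le, mul_pos he hp2]
    · have h1 := (hpot T (T * x) hT (by nlinarith)).2
      have h2 : T * x / T = x := by field_simp
      rw [h2] at h1
      calc L (T * x) / L T * x ^ (-γ) ≤ Real.exp 2 * x ^ δ * x ^ (-γ) := by
            gcongr; rwa [div_le_iff₀ hLT]
        _ = Real.exp 2 * x ^ (δ - γ) := by
            rw [mul_assoc, ← Real.rpow_add hx]; ring_nf
        _ ≤ _ := by nlinarith [mul_nonneg hD0 hp1.le, mul_nonneg hD0 hp2.le, mul_pos he hp1]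
  · have h1 := (hpot A T le_rfl hT).1
    have hTg := Real.rpow_pos_of_pos hT0 γ
    have hAg := Real.rpow_pos_of_pos hA γ
    have hTA : 0 < T / A := by positivity
    have h2 : T ^ γ / L T ≤ Real.exp 2 * A ^ γ / L A * (T / A) ^ (γ + δ) := by
      rw [Real.rpow_add hTA, div_le_iff₀ hLT, Real.div_rpow hT0.le hA.le γ]
      have : Real.exp 2 * A ^ γ / L A * (T ^ γ / A ^ γ * (T / A) ^ δ) * L T
          = T ^ γ * ((Real.exp 2 * (T / A) ^ δ * L T) / L A) := by
        field_simp
      rw [this]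
      exact le_mul_of_one_le_right hTg.le ((one_le_div hLA).2 h1)
    have h3 : (T / A) ^ (γ + δ) ≤ x ^ (-(γ + δ)) := by
      rw [Real.rpow_neg hx.le, ← Real.inv_rpow hx.le]
      refine Real.rpow_le_rpow hTA.le ?_ (by positivity)
      rw [div_le_iff₀ hA, inv_mul_eq_div, le_div_iff₀ hx]
      exact hAx.le
    rw [abs_mul, abs_of_nonneg (by positivity)]
    calc T ^ γ / L T * |R (T * x)|
        ≤ Real.exp 2 * A ^ γ / L A * x ^ (-(γ + δ)) * M := by
          gcongr
          · exact h2.trans (by gcongr)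
          · exact hM _ hTx.le
      _ = D * x ^ (-(γ + δ)) := by rw [hD]; ring
      _ ≤ _ := by nlinarith [mul_pos he hp1, mul_nonneg hD0 hp2.le, mul_pos he hp2]

/-- The double integral of the rescaled functions `x ↦ R (T x) T^γ / L T` converges to that of
`x ↦ x^(-γ)`. -/
theorem tendsto_double_integral_rescaled {γ : ℝ} (hγ : γ ∈ Set.Ioo (0 : ℝ) 1) {L R : ℝ → ℝ}
    (hLpos : ∀ t > 0, 0 < L t)
    (hLslow : ∀ s > 0, Tendsto (fun t => L (s * t) / L t) atTop (𝓝 1))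
    (hRbdd : ∃ M, ∀ t ≥ 0, |R t| ≤ M) (hRcont : ContinuousOn R (Set.Ici 0))
    (hRL : ∀ t > 0, R t = L t / t ^ γ) {h : ℝ} (hh : 0 ≤ h) :
    Tendsto (fun T => ∫ r in 0..h, ∫ x in 0..r, T ^ γ / L T * R (T * x)) atTop
      (𝓝 (∫ r in 0..h, ∫ x in 0..r, x ^ (-γ))) := by
  obtain ⟨hγ0, hγ1⟩ := hγ
  have hLcont : ContinuousOn L (Set.Ioi 0) := by
    have h1 : ContinuousOn (fun t => R t * t ^ γ) (Set.Ioi 0) :=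
      (hRcont.mono Set.Ioi_subset_Ici_self).mul
        (Real.continuous_rpow_const hγ0.le).continuousOn
    refine h1.congr fun t ht => ?_
    change L t = R t * t ^ γ
    rw [hRL t ht, div_mul_cancel₀ _ (Real.rpow_pos_of_pos ht γ).ne']
  obtain ⟨C, A, hA, hdom⟩ := exists_abs_rescaled_le (δ := (1 - γ) / 2) hγ0 (by linarith)
    hLpos hLslow hLcont hRbdd hRL
  set g : ℝ → ℝ := fun x => C * (x ^ (-(γ + (1 - γ) / 2)) + x ^ ((1 - γ) / 2 - γ)) with hg
  have hgint : ∀ a b, IntervalIntegrable g volume a b := fun a b =>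
    ((intervalIntegral.intervalIntegrable_rpow' (by linarith)).add
      (intervalIntegral.intervalIntegrable_rpow' (by linarith))).const_mul C
  have hcont : ∀ T ≥ A, ∀ r,
      ContinuousOn (fun x => T ^ γ / L T * R (T * x)) (Set.Icc 0 r) := fun T hT r =>
    continuousOn_const.mul (hRcont.comp (by fun_prop) fun x hx =>
      mul_nonneg (hA.trans_le hT).le hx.1)
  have hinner : ∀ r, 0 ≤ r → Tendsto (fun T => ∫ x in 0..r, T ^ γ / L T * R (T * x)) atTop
      (𝓝 (∫ x in 0..r, x ^ (-γ))) := by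
    intro r hr
    refine intervalIntegral.tendsto_integral_filter_of_dominated_convergence g ?_ ?_ (hgint 0 r) ?_
    · filter_upwards [eventually_ge_atTop A] with T hT
      rw [Set.uIoc_of_le hr]
      exact ((hcont T hT r).mono Set.Ioc_subset_Icc_self).aestronglyMeasurable
        measurableSet_Ioc
    · filter_upwards [eventually_ge_atTop A] with T hT
      refine ae_of_all _ fun x hx => ?_
      rw [Set.uIoc_of_le hr] at hx
      exact hdom T hT x hx.1
    · refine ae_of_all _ fun x hx => ?_
      rw [Set.uIoc_of_le hr] at hx
      have hx0 := hx.1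
      have h1 := (hLslow x hx0).mul_const (x ^ (-γ))
      rw [one_mul] at h1
      refine h1.congr' ?_
      filter_upwards [eventually_gt_atTop 0] with T hT
      have := Real.rpow_pos_of_pos hT γ
      have := Real.rpow_pos_of_pos hx0 γ
      have := hLpos T hT
      rw [hRL _ (mul_pos hT hx0), Real.mul_rpow hT.le hx0.le, Real.rpow_neg hx0.le, mul_comm x T]
      field_simp
  refine intervalIntegral.tendsto_integral_filter_of_dominated_convergence
    (fun r => ∫ x in 0..r, g x) ?_ ?_ ?_ ?_
  · filter_upwards [eventually_ge_atTop A] with T hT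
    have h1 : ContinuousOn (fun r => ∫ x in 0..r, T ^ γ / L T * R (T * x)) (Set.uIcc 0 h) := by
      refine intervalIntegral.continuousOn_primitive_interval ?_
      rw [Set.uIcc_of_le hh]
      exact (hcont T hT h).integrableOn_Icc
    exact (h1.mono Set.uIoc_subset_uIcc).aestronglyMeasurable measurableSet_uIoc
  · filter_upwards [eventually_ge_atTop A] with T hT
    refine ae_of_all _ fun r hr => ?_
    rw [Set.uIoc_of_le hh] at hr
    exact intervalIntegral.norm_integral_le_of_norm_le hr.1.le
      (ae_of_all _ fun x hx => hdom T hT x hx.1) (hgint 0 r)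
  · refine ContinuousOn.intervalIntegrable ?_
    exact intervalIntegral.continuousOn_primitive_interval' (hgint 0 h) Set.left_mem_uIcc
  · refine ae_of_all _ fun r hr => hinner r ?_
    rw [Set.uIoc_of_le hh] at hr
    exact hr.1.le

theorem integral_integral_rpow_neg {γ : ℝ} (hγ : γ < 1) (h : ℝ) :
    ∫ r in 0..h, ∫ x in 0..r, x ^ (-γ) = h ^ (2 - γ) / ((1 - γ) * (2 - γ)) := by
  have h1 : ∀ r : ℝ, ∫ x in 0..r, x ^ (-γ) = r ^ (1 - γ) / (1 - γ) := fun r => by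
    rw [integral_rpow (Or.inl (by linarith)), Real.zero_rpow (by linarith)]
    ring_nf
  simp only [h1, intervalIntegral.integral_div]
  rw [integral_rpow (Or.inl (by linarith)), Real.zero_rpow (by linarith), sub_zero,
    show 1 - γ + 1 = 2 - γ by ring, div_div, mul_comm (2 - γ)]

/-- For `γ ∈ (0,1)`, `R(t) = L(t)/t^γ` with `L` slowly varying,
`𝓗 = 1 − γ/2` and `σ(ε)² = L(ε⁻²) ε^{2γ}`, for all `0 ≤ s ≤ t`,
`(2/σ(ε)²) ∫_s^t ∫_s^{r₁} R((r₁−r₂)/ε²) dr₂ dr₁ → (t−s)^{2𝓗}/(𝓗(2𝓗−1))` as `ε → 0⁺`. -/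
theorem stmt_7 (γ : ℝ) (hγ : γ ∈ Set.Ioo (0:ℝ) 1)
    (L : ℝ → ℝ) (hLpos : ∀ t > 0, 0 < L t)
    (hLslow : ∀ s > 0, Tendsto (fun t => L (s * t) / L t) atTop (𝓝 1))
    (R : ℝ → ℝ) (hRbdd : ∃ M, ∀ t ≥ 0, |R t| ≤ M)
    (hRcont : ContinuousOn R (Set.Ici 0))
    (hRL : ∀ t > 0, R t = L t / t ^ γ) :
    ∀ s t : ℝ, 0 ≤ s → s ≤ t →
      Tendsto (fun ε : ℝ =>
          (2 / (L ((ε ^ 2)⁻¹) * ε ^ (2 * γ))) *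
            ∫ r₁ in s..t, ∫ r₂ in s..r₁, R ((r₁ - r₂) / ε ^ 2))
        (𝓝[>] 0)
        (𝓝 ((t - s) ^ (2 * (1 - γ / 2)) / ((1 - γ / 2) * (2 * (1 - γ / 2) - 1)))) := by
  intro s t _ hst
  have hh : 0 ≤ t - s := sub_nonneg.2 hst
  have hT : Tendsto (fun ε : ℝ => (ε ^ 2)⁻¹) (𝓝[>] 0) atTop := by
    refine tendsto_inv_nhdsGT_zero.comp (tendsto_nhdsWithin_iff.2 ⟨?_, ?_⟩)
    · have : Tendsto (fun ε : ℝ => ε ^ 2) (𝓝 0) (𝓝 (0 ^ 2)) := (continuous_pow 2).tendsto 0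
      rw [zero_pow two_ne_zero] at this
      exact this.mono_left nhdsWithin_le_nhds
    · filter_upwards [self_mem_nhdsWithin] with ε hε
      exact pow_pos (Set.mem_Ioi.1 hε) 2
  have hlim := ((tendsto_double_integral_rescaled hγ hLpos hLslow hRbdd hRcont hRL hh).comp
    hT).const_mul 2
  rw [integral_integral_rpow_neg hγ.2] at hlim
  have hval : (t - s) ^ (2 * (1 - γ / 2)) / ((1 - γ / 2) * (2 * (1 - γ / 2) - 1))
      = 2 * ((t - s) ^ (2 - γ) / ((1 - γ) * (2 - γ))) := by
    rw [show 2 * (1 - γ / 2) = 2 - γ by ring,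
      show (1 - γ / 2) * (2 - γ - 1) = (1 - γ) * (2 - γ) / 2 by ring]
    rw [div_div_eq_mul_div]
    ring
  rw [hval]
  refine hlim.congr' ?_
  filter_upwards [self_mem_nhdsWithin] with ε hε
  have hε0 : 0 < ε := hε
  have hinner : ∀ r, ∫ r₂ in s..r, R ((r - r₂) / ε ^ 2) = ∫ x in 0..(r - s), R (x / ε ^ 2) :=
    fun r => by
      rw [intervalIntegral.integral_comp_sub_left (fun x => R (x / ε ^ 2)) r, sub_self]
  have hscale : ((ε ^ 2)⁻¹ : ℝ) ^ γ = (ε ^ (2 * γ))⁻¹ := by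
    rw [Real.inv_rpow (by positivity), Real.rpow_mul hε0.le, Real.rpow_two]
  simp only [hinner, Function.comp_apply, intervalIntegral.integral_const_mul, hscale]
  rw [intervalIntegral.integral_comp_sub_right (fun r => ∫ x in 0..r, R (x / ε ^ 2)) s, sub_self]
  simp only [inv_mul_eq_div]
  ring
end
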